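/- arXiv:1212.5706 — 2 statements merged into one kernel-verified Lean document; each statement's English description precedes it below -/
import Mathlib

section
/- Let F be ℝ, ℂ or ℍ, let K be respectively SO(n), SU(n), Sp(n) acting on V = Fⁿ with n ≥ 5, and let H be a subgroup of K such that V decomposes into three nonzero H-invariant F-subspaces V = V₁ ⊕ V₂ ⊕ V₃. If a subgroup G of K leaves invariant a proper nonzero F-subspace W of V, then G × H does not act with cohomogeneity at most one on K by left and right translations; equivalently, the action of H on the Grassmannian K/K_W of subspaces of V of the same dimension as W (where K_W = {k ∈ K : k·W = W}) has orbit space of dimension at least two. -/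
/-! Statement 8: with `F ∈ {ℝ, ℂ, ℍ}`, `K` respectively `SO n`, `SU n`, `Sp n` (`n ≥ 5`),
if `Fⁿ` decomposes into three nonzero `H`-invariant subspaces for a subgroup `H ⊆ K`, and a
subgroup `G ⊆ K` leaves a proper nonzero subspace `W` invariant, then `G × H` does not act
with cohomogeneity at most one on `K` by left and right translations. -/
open Module

noncomputable section

/-- The tangent space at `x` of a set `S` of matrices: the span of all entrywise
velocities at `0` of curves in `S` passing through `x`. -/
def matTangentAt {m n R : Type*} [NormedAddCommGroup R] [NormedSpace ℝ R]
    (S : Set (Matrix m n R)) (x : Matrix m n R) : Submodule ℝ (Matrix m n R) :=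
  Submodule.span ℝ {w | ∃ c : ℝ → Matrix m n R, (∀ t, c t ∈ S) ∧ c 0 = x ∧
    ∀ i j, HasDerivAt (fun t => c t i j) (w i j) 0}

variable {n : Type*} {R : Type*} [Fintype n] [DecidableEq n] [Semiring R] [StarRing R]

/-- A set of square matrices is a subgroup (of a unitary group) if it contains `1` and is
closed under multiplication and conjugate transposition (= inversion, for unitary
matrices). -/
def IsMatSubgroup (G : Set (Matrix n n R)) : Prop :=
  (1 : Matrix n n R) ∈ G ∧ (∀ a ∈ G, ∀ b ∈ G, a * b ∈ G) ∧ ∀ a ∈ G, star a ∈ G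

/-- The orbit of `k` under the action of `G × H` by left and right translations,
`(g, h) · k = g * k * h⁻¹` (for unitary matrices `h⁻¹ = star h`). -/
def lrOrbit (G H : Set (Matrix n n R)) (k : Matrix n n R) : Set (Matrix n n R) :=
  {x | ∃ g ∈ G, ∃ h ∈ H, x = g * k * star h}

/-- The dimension of a matrix group: the dimension of its tangent space at `1`. -/
def grpDim [NormedAddCommGroup R] [NormedSpace ℝ R] (K : Set (Matrix n n R)) : ℕ :=
  finrank ℝ (matTangentAt K 1)

/-- The cohomogeneity of the action of `G × H` on `K` by left and right translations:
`dim K` minus the maximal orbit dimension. -/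
def lrCohomogeneity [NormedAddCommGroup R] [NormedSpace ℝ R]
    (G H K : Set (Matrix n n R)) : ℕ :=
  grpDim K - ⨆ k : K, finrank ℝ (matTangentAt (lrOrbit G H k) (k : Matrix n n R))

end

noncomputable section

/-- The special orthogonal group `SO n` as a set of real matrices. -/
def SOSet (n : ℕ) : Set (Matrix (Fin n) (Fin n) ℝ) :=
  {A | star A * A = 1 ∧ A * star A = 1 ∧ A.det = 1}

/-- The special unitary group `SU n` as a set of complex matrices. -/
def SUSet (n : ℕ) : Set (Matrix (Fin n) (Fin n) ℂ) :=
  {A | star A * A = 1 ∧ A * star A = 1 ∧ A.det = 1}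

/-- The compact symplectic group `Sp n`: quaternionic `n × n` unitary matrices. -/
def SpSet (n : ℕ) : Set (Matrix (Fin n) (Fin n) (Quaternion ℝ)) :=
  {A | star A * A = 1 ∧ A * star A = 1}

end

section Algebra

variable {A ι : Type*} [Ring A] [StarRing A]

/-- The directions `c` for which `⁅c, q⁆` is automatically normal to an orbit of projections
commuting with the `e i`: the `e i` themselves and, whenever `e i` commutes with `q`, the
self-adjoint elements that are off-diagonal with respect to `e i`. -/
def IsNormalDirection (e : ι → A) (q c : A) : Prop :=
  star c = c ∧ ((∃ i, c = e i) ∨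
    ∃ i, Commute (e i) q ∧ e i * c * e i = 0 ∧ (1 - e i) * c * (1 - e i) = 0)

/-- Two normal directions with linearly independent brackets with `q`. -/
def HasTwoNormalDirections [Algebra ℝ A] (e : ι → A) (q : A) : Prop :=
  ∃ c d : A, IsNormalDirection e q c ∧ IsNormalDirection e q d ∧
    LinearIndependent ℝ ![c * q - q * c, d * q - q * d]

lemma IsNormalDirection.compl {e : ι → A} {q c : A} (h : IsNormalDirection e (1 - q) c) :
    IsNormalDirection e q c := by
  obtain ⟨hc, h | ⟨i, hi, h⟩⟩ := h
  · exact ⟨hc, Or.inl h⟩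
  · refine ⟨hc, Or.inr ⟨i, ?_, h⟩⟩
    simpa using (Commute.one_right (e i)).sub_right hi

lemma HasTwoNormalDirections.compl [Algebra ℝ A] {e : ι → A} {q : A} (h : HasTwoNormalDirections e (1 - q)) :
    HasTwoNormalDirections e q := by
  obtain ⟨c, d, hc, hd, h⟩ := h
  refine ⟨c, d, hc.compl, hd.compl, ?_⟩
  rw [LinearIndependent.pair_iff] at h ⊢
  intro s t hst
  apply h s t
  have h₁ : ∀ x : A, x * (1 - q) - (1 - q) * x = -(x * q - q * x) := fun x => by noncomm_ring
  rw [h₁, h₁, smul_neg, smul_neg, ← neg_add, hst, neg_zero]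

/-- An element sandwiched between orthogonal corners gives a normal direction. -/
lemma isNormalDirection_add_star {e : ι → A} {q x : A} {i : ι} (he : IsStarProjection (e i))
    (hq : Commute (e i) q) (hl : e i * x = x) (hr : x * e i = 0) :
    IsNormalDirection e q (x + star x) := by
  have hs : star (e i) = e i := he.isSelfAdjoint
  have hl' : star x * e i = star x := by simpa [hs] using congrArg star hl
  have hr' : e i * star x = 0 := by simpa [hs] using congrArg star hr
  refine ⟨by simp [add_comm], Or.inr ⟨i, hq, ?_, ?_⟩⟩
  · simp [mul_add, hl, hr', hr]
  · simp [mul_add, mul_sub, sub_mul, hl, hr', hl']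

lemma add_star_bracket {q x : A} (hq : IsStarProjection q) (hl : q * x = x) (hr : x * q = 0) :
    (x + star x) * q - q * (x + star x) = star x - x := by
  have hs : star q = q := hq.isSelfAdjoint
  have hl' : star x * q = star x := by simpa [hs] using congrArg star hl
  have hr' : q * star x = 0 := by simpa [hs] using congrArg star hr
  rw [add_mul, mul_add, hl, hr, hl', hr']
  abel

lemma hasTwoNormalDirections_of_forall_commute [Algebra ℝ A] {e : ι → A} {q : A}
    (hprime : ∀ a b : A, a ≠ 0 → b ≠ 0 → ∃ x, a * x * b ≠ 0)
    (he : ∀ i, IsStarProjection (e i)) (horth : ∀ i j, i ≠ j → e i * e j = 0)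
    (hq : IsStarProjection q) (hcomm : ∀ i, Commute (e i) q)
    {a b c : ι} (hab : a ≠ b) (hac : a ≠ c) (hbc : b ≠ c)
    (ha : e a * q ≠ 0) (hb : e b * (1 - q) ≠ 0) (hc : e c * (1 - q) ≠ 0) :
    HasTwoNormalDirections e q := by
  have hqq : q * q = q := hq.isIdempotentElem
  have key : ∀ j, a ≠ j → e j * (1 - q) ≠ 0 → ∃ x, x ≠ 0 ∧ e a * x = x ∧ x * e j = x ∧
      x * e a = 0 ∧ q * x = x ∧ x * q = 0 := by
    intro j haj hj
    obtain ⟨m, hm⟩ := hprime _ _ ha hj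
    have h₁ : (1 - q) * e j = e j * (1 - q) :=
      ((Commute.one_right (e j)).sub_right (hcomm j)).eq.symm
    refine ⟨_, hm, ?_, ?_, ?_, ?_, ?_⟩
    · simp only [← mul_assoc]; rw [(he a).isIdempotentElem.eq]
    · rw [mul_assoc, mul_assoc (e j), h₁, ← mul_assoc (e j), (he j).isIdempotentElem.eq]
    · rw [mul_assoc, mul_assoc (e j), ((Commute.one_right (e a)).sub_right (hcomm a)).eq.symm,
        ← mul_assoc (e j), horth j a haj.symm]; simp
    · simp only [← mul_assoc]; rw [← (hcomm a).eq, mul_assoc (e a), hqq]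
    · rw [mul_assoc, mul_assoc (e j), sub_mul, one_mul, hqq]; simp
  obtain ⟨x, hx, hx₁, hx₂, hx₃, hx₄, hx₅⟩ := key b hab hb
  obtain ⟨y, hy, hy₁, hy₂, hy₃, hy₄, hy₅⟩ := key c hac hc
  refine ⟨_, _, isNormalDirection_add_star (he a) (hcomm a) hx₁ hx₃,
    isNormalDirection_add_star (he a) (hcomm a) hy₁ hy₃, ?_⟩
  rw [add_star_bracket hq hx₄ hx₅, add_star_bracket hq hy₄ hy₅, LinearIndependent.pair_iff]
  intro s t hst
  have hs : star (e a) = e a := (he a).isSelfAdjoint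
  have hx' : e a * star x = 0 := by simpa [hs] using congrArg star hx₃
  have hy' : e a * star y = 0 := by simpa [hs] using congrArg star hy₃
  have h₂ : s • x + t • y = 0 := by
    have := congrArg (fun z => - (e a * z)) hst
    simpa [mul_add, mul_sub, hx₁, hy₁, hx', hy', add_comm] using this
  have hyb : y * e b = 0 := by rw [← hy₂, mul_assoc, horth c b hbc.symm, mul_zero]
  have hxc : x * e c = 0 := by rw [← hx₂, mul_assoc, horth b c hbc, mul_zero]
  constructor
  · have := congrArg (· * e b) h₂
    simpa [add_mul, hx₂, hyb, hx] using this
  · have := congrArg (· * e c) h₂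
    simpa [add_mul, hxc, hy₂, hy] using this

lemma hasTwoNormalDirections_of_corner [Algebra ℝ A] {e : ι → A} {q : A}
    (hprime : ∀ a b : A, a ≠ 0 → b ≠ 0 → ∃ x, a * x * b ≠ 0)
    (he : ∀ i, IsStarProjection (e i)) (horth : ∀ i j, i ≠ j → e i * e j = 0)
    (hq : IsStarProjection q) {a c : ι} (hac : a ≠ c) (hc : Commute (e c) q)
    (ha : ¬ Commute (e a) q) (hcq : e c * q ≠ 0) :
    HasTwoNormalDirections e q := by
  have hqq : q * q = q := hq.isIdempotentElem
  have hee : e c * e c = e c := (he c).isIdempotentElem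
  have hsq : star q = q := hq.isSelfAdjoint
  have hsa : star (e a) = e a := (he a).isSelfAdjoint
  have hsc : star (e c) = e c := (he c).isSelfAdjoint
  have hb : (1 - q) * (1 - e c) ≠ 0 := by
    intro h0
    apply ha
    have h₁ : (1 - e c) * e a = e a := by rw [sub_mul, horth c a hac.symm]; simp
    have h₂ : q * e a = e a := by
      have : (1 - q) * e a = 0 := by rw [← h₁, ← mul_assoc, h0, zero_mul]
      rw [sub_mul, one_mul, sub_eq_zero] at this
      exact this.symm
    have h₃ : e a * q = e a := by simpa [hsa, hsq] using congrArg star h₂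
    rw [Commute, SemiconjBy, h₂, h₃]
  obtain ⟨m, hm⟩ := hprime _ _ hcq hb
  set x := e c * q * m * ((1 - q) * (1 - e c)) with hxdef
  have hx₁ : e c * x = x := by rw [hxdef]; simp only [← mul_assoc]; rw [hee]
  have hx₂ : x * e c = 0 := by
    rw [hxdef, mul_assoc, mul_assoc (1 - q), sub_mul 1 (e c), hee]; simp
  have hx₃ : q * x = x := by
    rw [hxdef]; simp only [← mul_assoc]; rw [← hc.eq, mul_assoc (e c), hqq]
  have hx₄ : x * q = 0 := by
    have h₁ : (1 - e c) * q = q * (1 - e c) := by rw [sub_mul, mul_sub, hc.eq]; simp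
    rw [hxdef, mul_assoc, mul_assoc (1 - q), h₁, ← mul_assoc (1 - q), sub_mul, hqq]; simp
  refine ⟨_, _, ⟨hsa, Or.inl ⟨a, rfl⟩⟩, isNormalDirection_add_star (he c) hc hx₁ hx₂, ?_⟩
  rw [add_star_bracket hq hx₃ hx₄, LinearIndependent.pair_iff]
  intro s t hst
  have hx' : e c * star x = 0 := by simpa [hsc] using congrArg star hx₂
  have h₁ : e c * (e a * q - q * e a) = 0 := by
    rw [mul_sub, ← mul_assoc, horth c a hac.symm, ← mul_assoc, hc.eq, mul_assoc,
      horth c a hac.symm]; simp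
  have ht : t = 0 := by
    have := congrArg (e c * ·) hst
    simpa [mul_add, h₁, mul_sub (e c) (star x), hx₁, hx', hm] using this
  refine ⟨?_, ht⟩
  rw [ht, zero_smul, add_zero, smul_eq_zero] at hst
  exact hst.resolve_right fun h => ha (sub_eq_zero.mp h)

lemma hasTwoNormalDirections_of_commute [Algebra ℝ A] {e : ι → A} {q : A}
    (hprime : ∀ a b : A, a ≠ 0 → b ≠ 0 → ∃ x, a * x * b ≠ 0)
    (he : ∀ i, IsStarProjection (e i)) (hne : ∀ i, e i ≠ 0)
    (horth : ∀ i j, i ≠ j → e i * e j = 0)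
    (hq : IsStarProjection q) (hq0 : q ≠ 0) (hq1 : q ≠ 1)
    {a b c : ι} (hab : a ≠ b) (hac : a ≠ c) (hbc : b ≠ c) (hι : ∀ i, i = a ∨ i = b ∨ i = c)
    (hsum : e a + e b + e c = 1) (hc : Commute (e c) q) :
    HasTwoNormalDirections e q := by
  have hor : ∀ i, e i * (1 - q) ≠ 0 ∨ e i * q ≠ 0 := by
    intro i
    by_contra! h
    apply hne i
    calc e i = e i * (1 - q) + e i * q := by noncomm_ring
      _ = 0 := by rw [h.1, h.2, add_zero]
  by_cases ha : Commute (e a) q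
  · have hb : Commute (e b) q := by
      have : e b = 1 - e a - e c := by rw [← hsum]; abel
      rw [this]
      exact ((Commute.one_left q).sub_left ha).sub_left hc
    have hcomm : ∀ i, Commute (e i) q := by
      intro i
      rcases hι i with rfl | rfl | rfl <;> assumption
    have hcomm' : ∀ i, Commute (e i) (1 - q) := fun i =>
      (Commute.one_right (e i)).sub_right (hcomm i)
    have h₁ : e a * q ≠ 0 ∨ e b * q ≠ 0 ∨ e c * q ≠ 0 := by
      by_contra! h
      apply hq0
      rw [← one_mul q, ← hsum, add_mul, add_mul, h.1, h.2.1, h.2.2]; simp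
    have h₂ : e a * (1 - q) ≠ 0 ∨ e b * (1 - q) ≠ 0 ∨ e c * (1 - q) ≠ 0 := by
      by_contra! h
      apply hq1
      refine (sub_eq_zero.mp ?_).symm
      rw [← one_mul (1 - q)]
      nth_rw 1 [← hsum]
      rw [add_mul, add_mul, h.1, h.2.1, h.2.2]; simp
    have mixed : ∀ {i j k : ι}, i ≠ j → i ≠ k → j ≠ k → e i * q ≠ 0 → e j * (1 - q) ≠ 0 →
        HasTwoNormalDirections e q := by
      intro i j k hij hik hjk hi hj
      rcases hor k with hk | hk
      · exact hasTwoNormalDirections_of_forall_commute hprime he horth hq hcomm hij hik hjk hi hj hk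
      · exact (hasTwoNormalDirections_of_forall_commute hprime he horth hq.one_sub hcomm'
          hij.symm hjk hik hj (by simpa using hi) (by simpa using hk)).compl
    have same : ∀ {i j k : ι}, i ≠ j → i ≠ k → j ≠ k → e i * q ≠ 0 → e i * (1 - q) ≠ 0 →
        HasTwoNormalDirections e q := by
      intro i j k hij hik hjk hi hi'
      rcases hor j with hj | hj
      · exact mixed hij hik hjk hi hj
      · exact mixed hij.symm hjk hik hj hi'
    rcases h₁ with h₁ | h₁ | h₁ <;> rcases h₂ with h₂ | h₂ | h₂
    · exact same hab hac hbc h₁ h₂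
    · exact mixed hab hac hbc h₁ h₂
    · exact mixed hac hab hbc.symm h₁ h₂
    · exact mixed hab.symm hbc hac h₁ h₂
    · exact same hab.symm hbc hac h₁ h₂
    · exact mixed hbc hab.symm hac.symm h₁ h₂
    · exact mixed hac.symm hbc.symm hab h₁ h₂
    · exact mixed hbc.symm hac.symm hab.symm h₁ h₂
    · exact same hac.symm hbc.symm hab h₁ h₂
  · rcases hor c with h | h
    · refine (hasTwoNormalDirections_of_corner hprime he horth hq.one_sub hac
        ((Commute.one_right _).sub_right hc) (fun h' => ha ?_) h).compl
      simpa using (Commute.one_right (e a)).sub_right h'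
    · exact hasTwoNormalDirections_of_corner hprime he horth hq hac hc ha h

lemma hasTwoNormalDirections [Algebra ℝ A] {e : Fin 3 → A} {q : A}
    (hprime : ∀ a b : A, a ≠ 0 → b ≠ 0 → ∃ x, a * x * b ≠ 0)
    (he : ∀ i, IsStarProjection (e i)) (hne : ∀ i, e i ≠ 0)
    (horth : ∀ i j, i ≠ j → e i * e j = 0) (hsum : ∑ i, e i = 1)
    (hq : IsStarProjection q) (hq0 : q ≠ 0) (hq1 : q ≠ 1) :
    HasTwoNormalDirections e q := by
  rw [Fin.sum_univ_three] at hsum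
  have hcase : ∀ c, Commute (e c) q → HasTwoNormalDirections e q := by
    intro c hc
    have of_perm := @hasTwoNormalDirections_of_commute _ _ _ _ _ e q hprime he hne horth hq hq0 hq1
    fin_cases c
    · exact of_perm (a := 1) (b := 2) (c := 0) (by decide) (by decide) (by decide) (by decide)
        (by rw [← hsum]; abel) hc
    · exact of_perm (a := 0) (b := 2) (c := 1) (by decide) (by decide) (by decide) (by decide)
        (by rw [← hsum]; abel) hc
    · exact of_perm (a := 0) (b := 1) (c := 2) (by decide) (by decide) (by decide) (by decide)
        hsum hc
  by_contra hcon
  have hnc : ∀ c, ¬ Commute (e c) q := fun c hc => hcon (hcase c hc)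
  apply hcon
  refine ⟨e 0, e 1, ⟨(he 0).isSelfAdjoint, Or.inl ⟨0, rfl⟩⟩,
    ⟨(he 1).isSelfAdjoint, Or.inl ⟨1, rfl⟩⟩, ?_⟩
  rw [LinearIndependent.pair_iff]
  intro s t hst
  have hf : Commute (s • e 0 + t • e 1) q := by
    rw [Commute, SemiconjBy, ← sub_eq_zero, ← hst]
    simp only [add_mul, mul_add, smul_mul_assoc, mul_smul_comm, smul_sub]
    abel
  have of_smul : ∀ {r : ℝ} {c}, r ≠ 0 → ¬ Commute (r • e c) q := by
    intro r c hr h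
    apply hnc c
    have := h.smul_left r⁻¹
    rwa [smul_smul, inv_mul_cancel₀ hr, one_smul] at this
  have hff : (s • e 0 + t • e 1) * (s • e 0 + t • e 1) = (s * s) • e 0 + (t * t) • e 1 := by
    simp only [add_mul, mul_add, smul_mul_assoc, mul_smul_comm, smul_smul,
      (he _).isIdempotentElem.eq, horth 0 1 (by decide), horth 1 0 (by decide), smul_zero,
      add_zero, zero_add]
  by_cases hs : s = 0
  · by_contra hne'
    refine of_smul (r := t) (c := 1) (fun ht => hne' ⟨hs, ht⟩) ?_
    simpa [hs] using hf
  exfalso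
  by_cases hd : s = t
  · refine of_smul (r := s) (c := 2) hs ?_
    have h₁ : s • e 2 = s • 1 - (s • e 0 + t • e 1) := by
      rw [← hsum, ← hd]; simp only [smul_add]; abel
    rw [h₁]
    exact ((Commute.one_left q).smul_left s).sub_left hf
  · refine of_smul (r := s * (s - t)) (c := 0) (mul_ne_zero hs (sub_ne_zero.mpr hd)) ?_
    have h₁ : (s * (s - t)) • e 0 =
        (s • e 0 + t • e 1) * (s • e 0 + t • e 1) - t • (s • e 0 + t • e 1) := by
      rw [hff]; module
    rw [h₁]
    exact (hf.mul_left hf).sub_left (hf.smul_left t)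

/-- Brackets of normal directions with `q` are orthogonal to every `x` tangent to the orbit. -/
lemma IsNormalDirection.orthogonal [Algebra ℝ A] {e : ι → A} {q c x : A} {τ : A →ₗ[ℝ] ℝ}
    (hc : IsNormalDirection e q c) (hτ : ∀ a b, τ (a * b) = τ (b * a))
    (he : ∀ i, IsStarProjection (e i))
    (h₁ : ∀ i, τ (e i * (q * x - x * q)) = 0)
    (h₂ : ∀ i, Commute (e i) q → Commute (e i) (q * x - x * q)) :
    τ ((c * q - q * c) * x) = 0 := by
  have hswap : τ ((c * q - q * c) * x) = τ (c * (q * x - x * q)) := by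
    have := hτ q (c * x)
    simp only [sub_mul, mul_sub, map_sub, mul_assoc] at this ⊢
    rw [this]
  rw [hswap]
  obtain ⟨-, ⟨i, rfl⟩ | ⟨i, hi, hc₁, hc₂⟩⟩ := hc
  · exact h₁ i
  set y := q * x - x * q
  have hy : Commute (e i) y := h₂ i hi
  have hii := (he i).isIdempotentElem.eq
  have corner : ∀ p, p * p = p → Commute p y → p * c * p = 0 → τ (c * (p * y)) = 0 := by
    intro p hp hpy h0
    calc τ (c * (p * y)) = τ (c * p * (y * p)) := by
          rw [← hpy.eq, mul_assoc, ← mul_assoc p p, hp]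
      _ = τ (p * c * p * y) := by
          rw [← mul_assoc, hτ]; simp only [mul_assoc]
      _ = 0 := by rw [h0, zero_mul, map_zero]
  have := corner (e i) hii hy hc₁
  have := corner (1 - e i) (by simp [mul_sub, sub_mul, hii])
    ((Commute.one_left y).sub_left hy) hc₂
  calc τ (c * y) = τ (c * (e i * y)) + τ (c * ((1 - e i) * y)) := by
        rw [← map_add]; congr 1; noncomm_ring
    _ = 0 := by simp [*]

end Algebra

section Projection

open Matrix

variable {n R : Type*} [Fintype n] [DecidableEq n] [DivisionRing R] [StarRing R]

omit [DecidableEq n] in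
/-- Orthogonal projections onto spaces of row vectors, acting from the right. -/
lemma exists_rowProjection (hdef : ∀ u : n → R, u ⬝ᵥ star u = 0 → u = 0)
    (V : Submodule R (n → R)) :
    ∃ P : Matrix n n R, IsStarProjection P ∧ (∀ v, v ᵥ* P ∈ V) ∧ ∀ v ∈ V, v ᵥ* P = v := by
  obtain ⟨s, rfl⟩ := IsNoetherian.noetherian V
  classical
  suffices ∃ P : Matrix n n R, star P = P ∧ (∀ v, v ᵥ* P ∈ Submodule.span R (s : Set (n → R))) ∧
      ∀ v ∈ Submodule.span R (s : Set (n → R)), v ᵥ* P = v by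
    obtain ⟨P, h₁, h₂, h₃⟩ := this
    refine ⟨P, ⟨?_, h₁⟩, h₂, h₃⟩
    refine ext_iff_vecMul.mpr fun v => ?_
    rw [← vecMul_vecMul]
    exact h₃ _ (h₂ v)
  induction s using Finset.induction_on with
  | empty =>
    refine ⟨0, by simp, by simp, fun v hv => ?_⟩
    simp only [Finset.coe_empty, Submodule.span_empty, Submodule.mem_bot] at hv
    simp [hv]
  | insert w s hw ih =>
    obtain ⟨P, hP, hmem, hfix⟩ := ih
    have hle : Submodule.span R (s : Set (n → R)) ≤
        Submodule.span R ((insert w s : Finset (n → R)) : Set (n → R)) :=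
      Submodule.span_mono (by simp)
    have hw' : w ∈ Submodule.span R ((insert w s : Finset (n → R)) : Set (n → R)) :=
      Submodule.subset_span (by simp)
    set u := w - w ᵥ* P with hu
    have hu' : u ∈ Submodule.span R ((insert w s : Finset (n → R)) : Set (n → R)) :=
      sub_mem hw' (hle (hmem w))
    have huP : u ᵥ* P = 0 := by
      rw [hu, sub_vecMul, hfix _ (hmem w), sub_self]
    have hPu : P *ᵥ star u = 0 := by
      have := congrArg star huP
      rwa [star_vecMul, ← star_eq_conjTranspose, hP, star_zero] at this
    set d := u ⬝ᵥ star u with hd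
    have hsd : star d = d := by
      simp [hd, dotProduct, star_sum]
    have key : ∀ v, v ᵥ* (P + vecMulVec (fun i => star (u i) * d⁻¹) u) =
        v ᵥ* P + ((v ⬝ᵥ star u) * d⁻¹) • u := by
      intro v
      rw [vecMul_add, vecMul_vecMulVec]
      congr 2
      simp [dotProduct, Finset.sum_mul, mul_assoc]
    refine ⟨P + vecMulVec (fun i => star (u i) * d⁻¹) u, ?_, ?_, ?_⟩
    · rw [star_add, hP]
      congr 1
      ext i j
      simp [vecMulVec_apply, star_apply, star_inv₀, hsd, mul_assoc]
    · intro v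
      rw [key]
      exact add_mem (hle (hmem v)) (Submodule.smul_mem _ _ hu')
    · have hfix' : ∀ v ∈ Submodule.span R (s : Set (n → R)),
          v ᵥ* (P + vecMulVec (fun i => star (u i) * d⁻¹) u) = v := by
        intro v hv
        rw [key, hfix v hv]
        have : v ⬝ᵥ star u = 0 := by
          rw [← hfix v hv, ← dotProduct_mulVec, hPu, dotProduct_zero]
        simp [this]
      have hfixw : w ᵥ* (P + vecMulVec (fun i => star (u i) * d⁻¹) u) = w := by
        rw [key]
        by_cases h0 : u = 0
        · rw [h0, smul_zero, add_zero]
          exact (sub_eq_zero.mp h0).symm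
        · have hd0 : d ≠ 0 := fun h => h0 (hdef u h)
          have : w ⬝ᵥ star u = d := by
            have hw2 : w = u + w ᵥ* P := by rw [hu]; abel
            rw [hw2, add_dotProduct, ← dotProduct_mulVec, hPu, dotProduct_zero, add_zero]
          rw [this, mul_inv_cancel₀ hd0, one_smul, hu]; abel
      intro v hv
      induction hv using Submodule.span_induction with
      | mem x hx =>
        rcases Finset.mem_insert.mp (Finset.mem_coe.mp hx) with rfl | hx
        · exact hfixw
        · exact hfix' x (Submodule.subset_span hx)
      | zero => simp
      | add x y _ _ hx hy => rw [add_vecMul, hx, hy]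
      | smul a x _ hx => rw [smul_vecMul, hx]

omit [DecidableEq n] in
/-- The orthogonal projection onto an invariant subspace commutes with the group. -/
lemma rowProjection_commute {V : Submodule R (n → R)} {P h : Matrix n n R}
    (hP : star P = P) (hmem : ∀ v, v ᵥ* P ∈ V) (hfix : ∀ v ∈ V, v ᵥ* P = v)
    (h₁ : ∀ v ∈ V, v ᵥ* h ∈ V) (h₂ : ∀ v ∈ V, v ᵥ* star h ∈ V) : Commute P h := by
  have key : ∀ g : Matrix n n R, (∀ v ∈ V, v ᵥ* g ∈ V) → P * g * P = P * g := by
    intro g hg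
    refine ext_iff_vecMul.mpr fun v => ?_
    rw [← vecMul_vecMul, ← vecMul_vecMul]
    exact hfix _ (hg _ (hmem v))
  have := congrArg star (key _ h₂)
  simp only [star_mul, star_star, hP, ← mul_assoc] at this
  rw [Commute, SemiconjBy, ← key h h₁, this]

lemma exists_commuting_rowProjection (hdef : ∀ u : n → R, u ⬝ᵥ star u = 0 → u = 0)
    {G : Set (Matrix n n R)} (hG : ∀ g ∈ G, star g ∈ G) {W : Submodule R (n → R)}
    (hbot : W ≠ ⊥) (htop : W ≠ ⊤) (hW : ∀ g ∈ G, ∀ v ∈ W, v ᵥ* g ∈ W) :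
    ∃ P : Matrix n n R, IsStarProjection P ∧ P ≠ 0 ∧ P ≠ 1 ∧ ∀ g ∈ G, Commute P g := by
  obtain ⟨P, hP, hmem, hfix⟩ := exists_rowProjection hdef W
  refine ⟨P, hP, ?_, ?_, fun g hg => rowProjection_commute hP.isSelfAdjoint hmem hfix (hW g hg)
    (hW _ (hG g hg))⟩
  · rintro rfl
    exact hbot ((Submodule.eq_bot_iff _).mpr fun v hv => by simpa using (hfix v hv).symm)
  · rintro rfl
    exact htop (eq_top_iff.mpr fun v _ => by simpa using hmem v)

lemma exists_commuting_rowProjections (hdef : ∀ u : n → R, u ⬝ᵥ star u = 0 → u = 0)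
    {H : Set (Matrix n n R)} (hH : ∀ h ∈ H, star h ∈ H) {V₁ V₂ V₃ : Submodule R (n → R)}
    (h₁ : ∀ h ∈ H, ∀ v ∈ V₁, v ᵥ* h ∈ V₁) (h₂ : ∀ h ∈ H, ∀ v ∈ V₂, v ᵥ* h ∈ V₂)
    (n₁ : V₁ ≠ ⊥) (n₂ : V₂ ≠ ⊥) (n₃ : V₃ ≠ ⊥)
    (d₁₂ : Disjoint V₁ V₂) (d₃ : Disjoint (V₁ ⊔ V₂) V₃) :
    ∃ e : Fin 3 → Matrix n n R, (∀ i, IsStarProjection (e i)) ∧ (∀ i, e i ≠ 0) ∧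
      (∀ i j, i ≠ j → e i * e j = 0) ∧ ∑ i, e i = 1 ∧ ∀ i, ∀ h ∈ H, Commute (e i) h := by
  obtain ⟨P, hP, hmem, hfix⟩ := exists_rowProjection hdef V₁
  obtain ⟨Q, hQ, hmem', hfix'⟩ := exists_rowProjection hdef (V₁ ⊔ V₂)
  have hsP : star P = P := hP.isSelfAdjoint
  have hsQ : star Q = Q := hQ.isSelfAdjoint
  have hPP : P * P = P := hP.isIdempotentElem
  have hQQ : Q * Q = Q := hQ.isIdempotentElem
  have hPQ : P * Q = P := by
    refine ext_iff_vecMul.mpr fun v => ?_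
    rw [← vecMul_vecMul]
    exact hfix' _ (le_sup_left (a := V₁) (hmem v))
  have hQP : Q * P = P := by simpa [hsP, hsQ] using congrArg star hPQ
  have h₁₂ : ∀ h ∈ H, ∀ v ∈ V₁ ⊔ V₂, v ᵥ* h ∈ V₁ ⊔ V₂ := by
    intro h hh v hv
    obtain ⟨x, hx, y, hy, rfl⟩ := Submodule.mem_sup.mp hv
    rw [add_vecMul]
    exact Submodule.add_mem_sup (h₁ h hh x hx) (h₂ h hh y hy)
  have hPc : ∀ h ∈ H, Commute P h := fun h hh =>
    rowProjection_commute hsP hmem hfix (h₁ h hh) (h₁ _ (hH h hh))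
  have hQc : ∀ h ∈ H, Commute Q h := fun h hh =>
    rowProjection_commute hsQ hmem' hfix' (h₁₂ h hh) (h₁₂ _ (hH h hh))
  refine ⟨![P, Q - P, 1 - Q], ?_, ?_, ?_, ?_, ?_⟩
  · intro i
    fin_cases i
    · exact hP
    · refine ⟨?_, ?_⟩
      · change (Q - P) * (Q - P) = Q - P
        simp [mul_sub, sub_mul, hPP, hQQ, hPQ, hQP]
      · change star (Q - P) = Q - P
        rw [star_sub, hsP, hsQ]
    · exact hQ.one_sub
  · intro i
    fin_cases i
    · change P ≠ 0
      rintro rfl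
      exact n₁ ((Submodule.eq_bot_iff _).mpr fun v hv => by simpa using (hfix v hv).symm)
    · change Q - P ≠ 0
      intro h
      refine n₂ ((Submodule.eq_bot_iff _).mpr fun v hv => ?_)
      have hv' : v ∈ V₁ := by
        rw [← hfix' v (le_sup_right (a := V₁) hv), sub_eq_zero.mp h]
        exact hmem v
      exact (Submodule.disjoint_def.mp d₁₂) v hv' hv
    · change 1 - Q ≠ 0
      intro h
      refine n₃ ((Submodule.eq_bot_iff _).mpr fun v hv => ?_)
      have hv' : v ∈ V₁ ⊔ V₂ := by
        have := hmem' v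
        rwa [← sub_eq_zero.mp h, vecMul_one] at this
      exact (Submodule.disjoint_def.mp d₃) v hv' hv
  · intro i j hij
    fin_cases i <;> fin_cases j <;> first
      | exact absurd rfl hij
      | simp [mul_sub, sub_mul, hPP, hQQ, hPQ, hQP]
  · simp [Fin.sum_univ_three]
  · intro i h hh
    fin_cases i
    · exact hPc h hh
    · exact (hQc h hh).sub_left (hPc h hh)
    · exact (Commute.one_left h).sub_left (hQc h hh)

omit [StarRing R] in
lemma matrix_prime (a b : Matrix n n R) (ha : a ≠ 0) (hb : b ≠ 0) : ∃ x, a * x * b ≠ 0 := by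
  obtain ⟨i, j, hij⟩ : ∃ i j, a i j ≠ 0 := by
    by_contra! h
    exact ha (Matrix.ext h)
  obtain ⟨k, l, hkl⟩ : ∃ k l, b k l ≠ 0 := by
    by_contra! h
    exact hb (Matrix.ext h)
  refine ⟨Matrix.single j k 1, fun h => ?_⟩
  have := congrFun (congrFun h i) l
  rw [mul_assoc, mul_apply, Finset.sum_eq_single j] at this
  · simp [hij, hkl] at this
  · intro x _ hx
    rw [single_mul_apply_of_ne _ _ _ _ _ hx, mul_zero]
  · simp

end Projection

section Columns

open Matrix

variable {n R : Type*} [Fintype n] [DecidableEq n] [Field R] [StarRing R]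

omit [DecidableEq n] in
lemma IsStarProjection.matrix_transpose {P : Matrix n n R} (hP : IsStarProjection P) :
    IsStarProjection Pᵀ := by
  refine ⟨?_, ?_⟩
  · change Pᵀ * Pᵀ = Pᵀ
    rw [← transpose_mul, hP.isIdempotentElem.eq]
  · change star Pᵀ = Pᵀ
    have : star P = P := hP.isSelfAdjoint
    nth_rw 2 [← this]
    rfl

omit [DecidableEq n] [StarRing R] in
lemma commute_transpose_of {P g : Matrix n n R} (h : Commute P gᵀ) : Commute Pᵀ g := by
  have := congrArg transpose h.eq
  rw [transpose_mul, transpose_mul, transpose_transpose] at this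
  exact this.symm

lemma exists_commuting_colProjection (hdef : ∀ u : n → R, u ⬝ᵥ star u = 0 → u = 0)
    {G : Set (Matrix n n R)} (hG : ∀ g ∈ G, star g ∈ G) {W : Submodule R (n → R)}
    (hbot : W ≠ ⊥) (htop : W ≠ ⊤) (hW : ∀ g ∈ G, ∀ v ∈ W, g *ᵥ v ∈ W) :
    ∃ P : Matrix n n R, IsStarProjection P ∧ P ≠ 0 ∧ P ≠ 1 ∧ ∀ g ∈ G, Commute P g := by
  obtain ⟨P, hP, h0, h1, hc⟩ := exists_commuting_rowProjection hdef (G := {g | gᵀ ∈ G})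
    (fun g hg => hG _ hg) hbot htop (fun g hg v hv => by
      rw [← mulVec_transpose]; exact hW _ hg v hv)
  refine ⟨Pᵀ, hP.matrix_transpose, by simpa using h0, by simpa using h1, fun g hg => ?_⟩
  exact commute_transpose_of (hc gᵀ (by simpa using hg))

lemma exists_commuting_colProjections (hdef : ∀ u : n → R, u ⬝ᵥ star u = 0 → u = 0)
    {H : Set (Matrix n n R)} (hH : ∀ h ∈ H, star h ∈ H) {V₁ V₂ V₃ : Submodule R (n → R)}
    (h₁ : ∀ h ∈ H, ∀ v ∈ V₁, h *ᵥ v ∈ V₁) (h₂ : ∀ h ∈ H, ∀ v ∈ V₂, h *ᵥ v ∈ V₂)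
    (n₁ : V₁ ≠ ⊥) (n₂ : V₂ ≠ ⊥) (n₃ : V₃ ≠ ⊥)
    (d₁₂ : Disjoint V₁ V₂) (d₃ : Disjoint (V₁ ⊔ V₂) V₃) :
    ∃ e : Fin 3 → Matrix n n R, (∀ i, IsStarProjection (e i)) ∧ (∀ i, e i ≠ 0) ∧
      (∀ i j, i ≠ j → e i * e j = 0) ∧ ∑ i, e i = 1 ∧ ∀ i, ∀ h ∈ H, Commute (e i) h := by
  obtain ⟨e, he, h0, ho, hs, hc⟩ := exists_commuting_rowProjections hdef (H := {g | gᵀ ∈ H})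
    (fun g hg => hH _ hg)
    (fun g hg v hv => by rw [← mulVec_transpose]; exact h₁ _ hg v hv)
    (fun g hg v hv => by rw [← mulVec_transpose]; exact h₂ _ hg v hv) n₁ n₂ n₃ d₁₂ d₃
  refine ⟨fun i => (e i)ᵀ, fun i => (he i).matrix_transpose, fun i => by simpa using h0 i,
    fun i j hij => ?_, ?_, fun i g hg => commute_transpose_of (hc i gᵀ (by simpa using hg))⟩
  · rw [← transpose_mul, ho j i hij.symm, transpose_zero]
  · rw [← transpose_sum, hs, transpose_one]

end Columns

section Tangent

open Matrix

variable {n R : Type*} [Fintype n] [DecidableEq n] [NormedDivisionRing R] [NormedAlgebra ℝ R]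
  [StarRing R] [ContinuousStar R] [StarModule ℝ R]

/-- Entrywise differentiability of a curve of matrices at `0`. -/
def HasEntryDerivAt (c : ℝ → Matrix n n R) (w : Matrix n n R) : Prop :=
  ∀ i j, HasDerivAt (fun t => c t i j) (w i j) 0

omit [Fintype n] [DecidableEq n] [StarRing R] [ContinuousStar R] [StarModule ℝ R] in
lemma hasEntryDerivAt_const (a : Matrix n n R) : HasEntryDerivAt (fun _ => a) 0 :=
  fun i j => hasDerivAt_const 0 (a i j)

omit [Fintype n] [DecidableEq n] [StarRing R] [ContinuousStar R] [StarModule ℝ R] in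
lemma HasEntryDerivAt.unique {c : ℝ → Matrix n n R} {v w : Matrix n n R}
    (hv : HasEntryDerivAt c v) (hw : HasEntryDerivAt c w) : v = w :=
  Matrix.ext fun i j => (hv i j).unique (hw i j)

omit [DecidableEq n] [StarRing R] [ContinuousStar R] [StarModule ℝ R] in
lemma HasEntryDerivAt.mul {c d : ℝ → Matrix n n R} {v w : Matrix n n R}
    (hc : HasEntryDerivAt c v) (hd : HasEntryDerivAt d w) :
    HasEntryDerivAt (fun t => c t * d t) (v * d 0 + c 0 * w) := by
  intro i j
  simp only [mul_apply, Matrix.add_apply, ← Finset.sum_add_distrib]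
  exact HasDerivAt.fun_sum fun k _ => (hc i k).fun_mul (hd k j)

omit [Fintype n] [DecidableEq n] in
lemma HasEntryDerivAt.star {c : ℝ → Matrix n n R} {v : Matrix n n R}
    (hc : HasEntryDerivAt c v) : HasEntryDerivAt (fun t => star (c t)) (star v) :=
  fun i j => (hc j i).star

/-- The real linear functional `A ↦ re (tr A)` on matrices. -/
noncomputable def reTrace (re : R →L[ℝ] ℝ) : Matrix n n R →ₗ[ℝ] ℝ :=
  re.toLinearMap ∘ₗ Matrix.traceLinearMap n ℝ R

omit [DecidableEq n] [StarRing R] [ContinuousStar R] [StarModule ℝ R] in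
lemma reTrace_mul_comm {re : R →L[ℝ] ℝ} (hre : ∀ a b, re (a * b) = re (b * a))
    (a b : Matrix n n R) : reTrace re (a * b) = reTrace re (b * a) := by
  simp only [reTrace, LinearMap.comp_apply, traceLinearMap_apply, trace, diag_apply, mul_apply,
    map_sum, ContinuousLinearMap.coe_coe]
  rw [Finset.sum_comm]
  simp only [hre]

omit [DecidableEq n] [ContinuousStar R] [StarModule ℝ R] in
lemma eq_zero_of_reTrace_star_mul_self {re : R →L[ℝ] ℝ}
    (hpos : ∀ a, a ≠ 0 → 0 < re (star a * a)) {a : Matrix n n R}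
    (h : reTrace re (star a * a) = 0) : a = 0 := by
  have hnn : ∀ x, 0 ≤ re (Star.star x * x) := by
    intro x
    by_cases hx : x = 0
    · simp [hx]
    · exact (hpos x hx).le
  simp only [reTrace, LinearMap.comp_apply, traceLinearMap_apply, trace, diag_apply, mul_apply,
    map_sum, ContinuousLinearMap.coe_coe, star_apply] at h
  ext i j
  by_contra hij
  rw [Finset.sum_eq_zero_iff_of_nonneg fun _ _ => Finset.sum_nonneg fun _ _ => hnn _] at h
  have := h j (Finset.mem_univ j)
  rw [Finset.sum_eq_zero_iff_of_nonneg fun _ _ => hnn _] at this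
  exact (hpos _ hij).ne' (this i (Finset.mem_univ i))

omit [DecidableEq n] [StarRing R] [ContinuousStar R] [StarModule ℝ R] in
lemma HasEntryDerivAt.reTrace {c : ℝ → Matrix n n R} {v : Matrix n n R}
    (hc : HasEntryDerivAt c v) (re : R →L[ℝ] ℝ) :
    HasDerivAt (fun t => reTrace re (c t)) (reTrace re v) 0 := by
  simp only [_root_.reTrace, LinearMap.comp_apply, traceLinearMap_apply, trace, diag_apply,
    map_sum, ContinuousLinearMap.coe_coe]
  exact HasDerivAt.fun_sum fun i _ => re.hasFDerivAt.comp_hasDerivAt 0 (hc i i)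

/-- The constraints satisfied by the left-translated velocities of an orbit. -/
noncomputable def orbitConstraints (re : R →L[ℝ] ℝ) (e : Fin 3 → Matrix n n R) (q : Matrix n n R) :
    Submodule ℝ (Matrix n n R) where
  carrier := {x | star x = -x ∧ (∀ i, reTrace re (e i * (q * x - x * q)) = 0) ∧
    ∀ i, Commute (e i) q → Commute (e i) (q * x - x * q)}
  zero_mem' := by simp
  add_mem' := by
    rintro x y ⟨hx, hx', hx''⟩ ⟨hy, hy', hy''⟩
    have h : q * (x + y) - (x + y) * q = (q * x - x * q) + (q * y - y * q) := by noncomm_ring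
    refine ⟨by rw [star_add, hx, hy, neg_add], fun i => ?_, fun i hi => ?_⟩
    · rw [h, mul_add, map_add, hx', hy', add_zero]
    · rw [h]; exact (hx'' i hi).add_right (hy'' i hi)
  smul_mem' := by
    rintro r x ⟨hx, hx', hx''⟩
    have h : q * (r • x) - (r • x) * q = r • (q * x - x * q) := by
      rw [mul_smul_comm, smul_mul_assoc, smul_sub]
    refine ⟨by rw [star_smul, hx, star_trivial, smul_neg], fun i => ?_, fun i hi => ?_⟩
    · rw [h, mul_smul_comm, map_smul, hx', smul_zero]
    · rw [h]; exact (hx'' i hi).smul_right r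

lemma velocity_mem_orbitConstraints {re : R →L[ℝ] ℝ} (hre : ∀ a b, re (a * b) = re (b * a))
    {G H K : Set (Matrix n n R)} (hK : ∀ a ∈ K, star a * a = 1 ∧ a * star a = 1)
    (hG : G ⊆ K) (hH : H ⊆ K) {p : Matrix n n R} {e : Fin 3 → Matrix n n R}
    (hp : ∀ g ∈ G, Commute p g) (he : ∀ i, ∀ h ∈ H, Commute (e i) h)
    (hHs : ∀ h ∈ H, star h ∈ H)
    {k : Matrix n n R} (hk : k ∈ K) {c : ℝ → Matrix n n R} {w : Matrix n n R}
    (hc : ∀ t, c t ∈ lrOrbit G H k) (hc0 : c 0 = k) (hw : HasEntryDerivAt c w) :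
    star k * w ∈ orbitConstraints re e (star k * p * k) := by
  set q := star k * p * k with hq
  have hkk := hK k hk
  have hwx : w = k * (star k * w) := by rw [← mul_assoc, hkk.2, one_mul]
  set x := star k * w with hx
  have hunit : ∀ t, star (c t) * c t = 1 := by
    intro t
    obtain ⟨g, hg, h, hh, hgh⟩ := hc t
    rw [hgh]
    simp only [star_mul, star_star, mul_assoc]
    rw [← mul_assoc (star g), (hK g (hG hg)).1, one_mul, ← mul_assoc (star k), hkk.1, one_mul,
      (hK h (hH hh)).2]
  have hconj : ∀ t, ∃ h ∈ H, star (c t) * p * c t = h * q * star h := by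
    intro t
    obtain ⟨g, hg, h, hh, hgh⟩ := hc t
    refine ⟨h, hh, ?_⟩
    rw [hgh, hq]
    simp only [star_mul, star_star, mul_assoc]
    rw [← mul_assoc p g, (hp g hg).eq, mul_assoc g, ← mul_assoc (star g), (hK g (hG hg)).1,
      one_mul]
  have hskew : star x = -x := by
    have h₁ := hw.star.mul hw
    simp only [hunit] at h₁
    have h₂ := h₁.unique (hasEntryDerivAt_const 1)
    rw [hc0] at h₂
    rw [eq_neg_iff_add_eq_zero, ← h₂, hx, star_mul, star_star]
  have hderiv : HasEntryDerivAt (fun t => star (c t) * p * c t) (q * x - x * q) := by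
    have h₁ := (hw.star.mul (hasEntryDerivAt_const p)).mul hw
    convert h₁ using 1
    rw [hc0, hwx, star_mul, hskew, hq]
    noncomm_ring
  refine ⟨hskew, fun i => ?_, fun i hi => ?_⟩
  · have h₁ := (((hasEntryDerivAt_const (e i)).mul hderiv).reTrace re)
    have h₂ : (fun t => reTrace re (e i * (star (c t) * p * c t))) =
        fun _ => reTrace re (e i * q) := by
      funext t
      obtain ⟨h, hh, hgh⟩ := hconj t
      rw [hgh, mul_assoc h, ← mul_assoc (e i), (he i h hh).eq, mul_assoc h,
        reTrace_mul_comm hre h]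
      simp only [mul_assoc]
      rw [(hK h (hH hh)).1, mul_one]
    rw [h₂] at h₁
    simpa using h₁.unique (hasDerivAt_const 0 _)
  · have h₁ := (hasEntryDerivAt_const (e i)).mul hderiv
    have h₂ := hderiv.mul (hasEntryDerivAt_const (e i))
    have h₃ : (fun t => e i * (star (c t) * p * c t)) = fun t => star (c t) * p * c t * e i := by
      funext t
      obtain ⟨h, hh, hgh⟩ := hconj t
      rw [hgh]
      exact (((he i h hh).mul_right hi).mul_right (he i _ (hHs h hh))).eq
    rw [h₃] at h₁
    have h₄ := h₁.unique h₂
    rw [zero_mul, mul_zero, zero_add, add_zero] at h₄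
    exact h₄

/-- Every orbit of `G × H` on `K` has codimension at least two. -/
lemma finrank_tangent_orbit_add_two_le [FiniteDimensional ℝ R]
    {re : R →L[ℝ] ℝ} (hre : ∀ a b, re (a * b) = re (b * a))
    (hpos : ∀ a, a ≠ 0 → 0 < re (star a * a))
    {G H K : Set (Matrix n n R)} (hK : ∀ a ∈ K, star a * a = 1 ∧ a * star a = 1)
    (hKm : ∀ a ∈ K, ∀ b ∈ K, a * b ∈ K) (hKs : ∀ a ∈ K, star a ∈ K)
    (hbracket : ∀ a b : Matrix n n R, star a = a → star b = b →
      a * b - b * a ∈ matTangentAt K 1)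
    (hG : G ⊆ K) (hH : H ⊆ K) (hHs : ∀ h ∈ H, star h ∈ H)
    {p : Matrix n n R} (hps : IsStarProjection p) (hp0 : p ≠ 0) (hp1 : p ≠ 1)
    (hp : ∀ g ∈ G, Commute p g) {e : Fin 3 → Matrix n n R}
    (hes : ∀ i, IsStarProjection (e i)) (hne : ∀ i, e i ≠ 0)
    (horth : ∀ i j, i ≠ j → e i * e j = 0) (hsum : ∑ i, e i = 1)
    (he : ∀ i, ∀ h ∈ H, Commute (e i) h) {k : Matrix n n R} (hk : k ∈ K) :
    finrank ℝ (matTangentAt (lrOrbit G H k) k) + 2 ≤ grpDim K := by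
  have hkk := hK k hk
  set q := star k * p * k with hq
  have hpp : p * p = p := hps.isIdempotentElem
  have hsp : star p = p := hps.isSelfAdjoint
  have hpq : k * q * star k = p := by
    rw [hq]
    simp only [mul_assoc]
    rw [hkk.2, mul_one, ← mul_assoc, hkk.2, one_mul]
  have hqs : IsStarProjection q := by
    refine ⟨?_, ?_⟩
    · change q * q = q
      calc q * q = star k * (p * (k * star k) * p) * k := by rw [hq]; noncomm_ring
        _ = q := by rw [hkk.2, mul_one, hpp]
    · change star q = q
      simp only [hq, star_mul, star_star, hsp, mul_assoc]
  have hq0 : q ≠ 0 := by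
    intro h
    rw [h] at hpq
    exact hp0 (by simpa using hpq.symm)
  have hq1 : q ≠ 1 := by
    intro h
    rw [h, mul_one, hkk.2] at hpq
    exact hp1 hpq.symm
  set T := matTangentAt (lrOrbit G H k) k with hT
  set S := T.map (LinearMap.mulLeft ℝ (star k)) with hS
  have hfin : finrank ℝ S = finrank ℝ T := by
    refine (Submodule.equivMapOfInjective _ ?_ T).finrank_eq.symm
    intro a b hab
    have := congrArg (k * ·) hab
    simpa [← mul_assoc, hkk.2] using this
  have hSK : S ≤ matTangentAt K 1 := by
    rw [hS, hT, matTangentAt, Submodule.map_span_le]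
    rintro w ⟨c, hc, hc0, hw⟩
    refine Submodule.subset_span ⟨fun t => star k * c t, fun t => ?_, ?_, ?_⟩
    · obtain ⟨g, hg, h, hh, hgh⟩ := hc t
      simp only [hgh]
      exact hKm _ (hKs k hk) _ (hKm _ (hKm _ (hG hg) _ hk) _ (hKs _ (hH hh)))
    · simp only [hc0, hkk.1]
    · have hw' : HasEntryDerivAt c w := hw
      have h := (hasEntryDerivAt_const (star k)).mul hw'
      rw [zero_mul, zero_add] at h
      exact h
  have hSC : S ≤ orbitConstraints re e q := by
    rw [hS, hT, matTangentAt, Submodule.map_span_le]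
    rintro w ⟨c, hc, hc0, hw⟩
    exact velocity_mem_orbitConstraints hre hK hG hH hp he hHs hk hc hc0 hw
  obtain ⟨a, b, ha, hb, hab⟩ :=
    hasTwoNormalDirections matrix_prime hes hne horth hsum hqs hq0 hq1
  set u := ![a * q - q * a, b * q - q * b] with hu
  have hqsa : star q = q := hqs.isSelfAdjoint
  have hUK : Submodule.span ℝ (Set.range u) ≤ matTangentAt K 1 := by
    rw [Submodule.span_le]
    rintro _ ⟨i, rfl⟩
    fin_cases i
    · exact hbracket a q ha.1 hqsa
    · exact hbracket b q hb.1 hqsa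
  have hdisj : S ⊓ Submodule.span ℝ (Set.range u) = ⊥ := by
    rw [Submodule.eq_bot_iff]
    rintro z ⟨hz, hz'⟩
    have hzc := hSC hz
    have hort : ∀ y ∈ Submodule.span ℝ (Set.range u), reTrace re (y * z) = 0 := by
      intro y hy
      induction hy using Submodule.span_induction with
      | mem y hy =>
        obtain ⟨i, rfl⟩ := hy
        fin_cases i
        · exact ha.orthogonal (reTrace_mul_comm hre) hes hzc.2.1 hzc.2.2
        · exact hb.orthogonal (reTrace_mul_comm hre) hes hzc.2.1 hzc.2.2
      | zero => simp
      | add x y _ _ hx hy => rw [add_mul, map_add, hx, hy, add_zero]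
      | smul r x _ hx => rw [smul_mul_assoc, map_smul, hx, smul_zero]
    refine eq_zero_of_reTrace_star_mul_self hpos ?_
    rw [hzc.1, neg_mul, map_neg, hort z hz', neg_zero]
  have h₁ := Submodule.finrank_sup_add_finrank_inf_eq S (Submodule.span ℝ (Set.range u))
  rw [hdisj, finrank_bot, add_zero, finrank_span_eq_card hab, Fintype.card_fin, hfin] at h₁
  rw [← h₁]
  exact Submodule.finrank_mono (sup_le hSK hUK)

omit [ContinuousStar R] [StarModule ℝ R] in
lemma not_lrCohomogeneity_le_one {G H K : Set (Matrix n n R)} (hK1 : 1 ∈ K)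
    (h : ∀ k ∈ K, finrank ℝ (matTangentAt (lrOrbit G H k) k) + 2 ≤ grpDim K) :
    ¬ lrCohomogeneity G H K ≤ 1 := by
  have h₁ := h 1 hK1
  have h₂ : ⨆ k : K, finrank ℝ (matTangentAt (lrOrbit G H (k : Matrix n n R)) k) ≤
      grpDim K - 2 := by
    refine ciSup_le' fun k => ?_
    have := h k k.2
    omega
  unfold lrCohomogeneity
  omega

end Tangent

section Exponential

open Matrix NormedSpace

variable {n R : Type*} [Fintype n] [DecidableEq n] [NormedDivisionRing R] [NormedAlgebra ℝ R]

lemma hasDerivAt_comp_exp_smul {A E : Type*} [NormedRing A] [NormedAlgebra ℝ A] [CompleteSpace A]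
    [NormedAddCommGroup E] [NormedSpace ℝ E] (f : A →L[ℝ] E) (x : A) :
    HasDerivAt (fun t : ℝ => f (exp (t • x))) (f x) 0 := by
  have h := hasDerivAt_exp_smul_const (𝕂 := ℝ) x (0 : ℝ)
  rw [zero_smul, exp_zero, one_mul] at h
  exact f.hasFDerivAt.comp_hasDerivAt 0 h

open scoped Matrix.Norms.Operator in
lemma hasEntryDerivAt_exp_smul [FiniteDimensional ℝ R] (x : Matrix n n R) :
    HasEntryDerivAt (fun t : ℝ => exp (t • x)) x := by
  have : CompleteSpace R := FiniteDimensional.complete ℝ R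
  have : CompleteSpace (Matrix n n R) := FiniteDimensional.complete ℝ _
  exact fun i j => hasDerivAt_comp_exp_smul
    (Matrix.entryLinearMap ℝ R i j).toContinuousLinearMap x

variable [StarRing R] [ContinuousStar R] [StarModule ℝ R]

lemma star_exp_smul {x : Matrix n n R} (hx : star x = -x) (t : ℝ) :
    star (exp (t • x)) = exp (-(t • x)) := by
  rw [star_eq_conjTranspose, ← exp_conjTranspose, conjTranspose_smul, star_trivial,
    ← star_eq_conjTranspose, hx, smul_neg]

lemma exp_smul_mem_unitary [FiniteDimensional ℝ R] {x : Matrix n n R} (hx : star x = -x) (t : ℝ) :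
    star (exp (t • x)) * exp (t • x) = 1 ∧ exp (t • x) * star (exp (t • x)) = 1 := by
  have : CompleteSpace R := FiniteDimensional.complete ℝ R
  let _ : NormedAlgebra ℚ R := NormedAlgebra.restrictScalars ℚ ℝ R
  rw [star_exp_smul hx]
  constructor
  · rw [← Matrix.exp_add_of_commute _ _ (Commute.refl (t • x)).neg_left, neg_add_cancel, exp_zero]
  · rw [← Matrix.exp_add_of_commute _ _ (Commute.refl (t • x)).neg_right, add_neg_cancel, exp_zero]

omit [StarRing R] [ContinuousStar R] [StarModule ℝ R] in
/-- A matrix generating a one-parameter subgroup of `K` is tangent to `K` at `1`. -/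
lemma mem_matTangentAt_one [FiniteDimensional ℝ R] {K : Set (Matrix n n R)} {x : Matrix n n R}
    (h : ∀ t : ℝ, exp (t • x) ∈ K) : x ∈ matTangentAt K 1 :=
  Submodule.subset_span ⟨fun t => exp (t • x), h, by simp only [zero_smul, exp_zero],
    hasEntryDerivAt_exp_smul x⟩

omit [DecidableEq n] [ContinuousStar R] [StarModule ℝ R] [NormedAlgebra ℝ R] in
lemma star_bracket {a b : Matrix n n R} (ha : star a = a) (hb : star b = b) :
    star (a * b - b * a) = -(a * b - b * a) := by
  rw [star_sub, star_mul, star_mul, ha, hb, neg_sub]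

lemma det_exp_smul_real {x : Matrix n n ℝ} (hx : star x = -x) (t : ℝ) :
    (exp (t • x)).det = 1 := by
  have h₁ : exp (t • x) = exp ((t / 2) • x) * exp ((t / 2) • x) := by
    rw [← Matrix.exp_add_of_commute _ _ rfl, ← add_smul, add_halves]
  have h₂ := congrArg det (exp_smul_mem_unitary hx (t / 2)).1
  rw [det_mul, star_eq_conjTranspose, det_conjTranspose, det_one, star_trivial] at h₂
  rw [h₁, det_mul, h₂]

lemma det_exp_smul_of_isHermitian {a : Matrix n n ℂ} (ha : a.IsHermitian) (z : ℂ) :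
    (exp (z • a)).det = Complex.exp (z * a.trace) := by
  set U : Matrix n n ℂ := (ha.eigenvectorUnitary : Matrix n n ℂ) with hU
  have hUU : U * star U = 1 := Unitary.coe_mul_star_self ha.eigenvectorUnitary
  have hinv : U⁻¹ = star U := inv_eq_right_inv hUU
  have hunit : IsUnit U := IsUnit.of_mul_eq_one _ hUU
  have hspec : z • a =
      U * diagonal (fun i => z * (ha.eigenvalues i : ℂ)) * U⁻¹ := by
    conv_lhs => rw [ha.spectral_theorem]
    rw [Unitary.conjStarAlgAut_apply, hinv, ← Matrix.smul_mul, ← Matrix.mul_smul, ← diagonal_smul]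
    rfl
  rw [hspec, exp_conj _ _ hunit, det_conj hunit, exp_diagonal, det_diagonal,
    ha.trace_eq_sum_eigenvalues, Finset.mul_sum, Complex.exp_sum]
  refine Finset.prod_congr rfl fun i _ => ?_
  rw [Pi.coe_exp, Complex.exp_eq_exp_ℂ]
  rfl

lemma det_exp_smul_complex {x : Matrix n n ℂ} (hx : star x = -x) (htr : x.trace = 0) (t : ℝ) :
    (exp (t • x)).det = 1 := by
  have hh : (Complex.I • x).IsHermitian := by
    rw [IsHermitian, conjTranspose_smul, ← star_eq_conjTranspose, hx]
    simp
  have h₁ : t • x = (-(t : ℂ) * Complex.I) • (Complex.I • x) := by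
    rw [smul_smul, mul_assoc, Complex.I_mul_I]
    ext i j
    simp
  rw [h₁, det_exp_smul_of_isHermitian hh, trace_smul, htr]
  simp

end Exponential

lemma dotProduct_star_self_eq_zero_of_pos {n R : Type*} [Fintype n] [NormedDivisionRing R]
    [NormedAlgebra ℝ R] [StarRing R] {re : R →L[ℝ] ℝ} (hre : ∀ a b, re (a * b) = re (b * a))
    (hpos : ∀ a, a ≠ 0 → 0 < re (star a * a)) (u : n → R) (hu : u ⬝ᵥ star u = 0) : u = 0 := by
  have hnn : ∀ x, 0 ≤ re (x * star x) := by
    intro x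
    rw [hre]
    by_cases hx : x = 0
    · simp [hx]
    · exact (hpos x hx).le
  have h := congrArg re hu
  simp only [dotProduct, Pi.star_apply, map_sum, map_zero] at h
  rw [Finset.sum_eq_zero_iff_of_nonneg fun _ _ => hnn _] at h
  funext i
  by_contra hi
  have h₁ := h i (Finset.mem_univ i)
  rw [hre] at h₁
  exact (hpos _ hi).ne' h₁

section Groups

open Matrix

lemma star_mul_self_mul {A : Type*} [Monoid A] [StarMul A] {a b : A}
    (ha : star a * a = 1) (hb : star b * b = 1) : star (a * b) * (a * b) = 1 := by
  rw [star_mul, mul_assoc, ← mul_assoc (star a), ha, one_mul, hb]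

lemma mul_mul_star_self {A : Type*} [Monoid A] [StarMul A] {a b : A}
    (ha : a * star a = 1) (hb : b * star b = 1) : a * b * star (a * b) = 1 := by
  rw [star_mul, mul_assoc, ← mul_assoc b, hb, one_mul, ha]

lemma SOSet_mul_mem {n : ℕ} {a b : Matrix (Fin n) (Fin n) ℝ} (ha : a ∈ SOSet n)
    (hb : b ∈ SOSet n) : a * b ∈ SOSet n :=
  ⟨star_mul_self_mul ha.1 hb.1, mul_mul_star_self ha.2.1 hb.2.1, by
    rw [det_mul, ha.2.2, hb.2.2, one_mul]⟩

lemma SOSet_star_mem {n : ℕ} {a : Matrix (Fin n) (Fin n) ℝ} (ha : a ∈ SOSet n) :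
    star a ∈ SOSet n :=
  ⟨by rw [star_star, ha.2.1], by rw [star_star, ha.1], by
    rw [star_eq_conjTranspose, det_conjTranspose, ha.2.2, star_one]⟩

lemma SUSet_mul_mem {n : ℕ} {a b : Matrix (Fin n) (Fin n) ℂ} (ha : a ∈ SUSet n)
    (hb : b ∈ SUSet n) : a * b ∈ SUSet n :=
  ⟨star_mul_self_mul ha.1 hb.1, mul_mul_star_self ha.2.1 hb.2.1, by
    rw [det_mul, ha.2.2, hb.2.2, one_mul]⟩

lemma SUSet_star_mem {n : ℕ} {a : Matrix (Fin n) (Fin n) ℂ} (ha : a ∈ SUSet n) :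
    star a ∈ SUSet n :=
  ⟨by rw [star_star, ha.2.1], by rw [star_star, ha.1], by
    rw [star_eq_conjTranspose, det_conjTranspose, ha.2.2, star_one]⟩

lemma SpSet_mul_mem {n : ℕ} {a b : Matrix (Fin n) (Fin n) (Quaternion ℝ)} (ha : a ∈ SpSet n)
    (hb : b ∈ SpSet n) : a * b ∈ SpSet n :=
  ⟨star_mul_self_mul ha.1 hb.1, mul_mul_star_self ha.2 hb.2⟩

lemma SpSet_star_mem {n : ℕ} {a : Matrix (Fin n) (Fin n) (Quaternion ℝ)} (ha : a ∈ SpSet n) :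
    star a ∈ SpSet n :=
  ⟨by rw [star_star, ha.2], by rw [star_star, ha.1]⟩

lemma SOSet_bracket_mem {n : ℕ} (a b : Matrix (Fin n) (Fin n) ℝ) (ha : star a = a)
    (hb : star b = b) : a * b - b * a ∈ matTangentAt (SOSet n) 1 :=
  mem_matTangentAt_one fun t => ⟨(exp_smul_mem_unitary (star_bracket ha hb) t).1,
    (exp_smul_mem_unitary (star_bracket ha hb) t).2, det_exp_smul_real (star_bracket ha hb) t⟩

lemma SUSet_bracket_mem {n : ℕ} (a b : Matrix (Fin n) (Fin n) ℂ) (ha : star a = a)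
    (hb : star b = b) : a * b - b * a ∈ matTangentAt (SUSet n) 1 :=
  mem_matTangentAt_one fun t => ⟨(exp_smul_mem_unitary (star_bracket ha hb) t).1,
    (exp_smul_mem_unitary (star_bracket ha hb) t).2,
    det_exp_smul_complex (star_bracket ha hb) (by rw [trace_sub, trace_mul_comm, sub_self]) t⟩

instance : StarModule ℝ (Quaternion ℝ) where
  star_smul r a := by ext <;> simp

lemma SpSet_bracket_mem {n : ℕ} (a b : Matrix (Fin n) (Fin n) (Quaternion ℝ)) (ha : star a = a)
    (hb : star b = b) : a * b - b * a ∈ matTangentAt (SpSet n) 1 :=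
  mem_matTangentAt_one fun t => exp_smul_mem_unitary (star_bracket ha hb) t

/-- The real part of a quaternion as a continuous linear functional. -/
noncomputable def quaternionRe : Quaternion ℝ →L[ℝ] ℝ :=
  LinearMap.toContinuousLinearMap
    { toFun := fun a => a.re
      map_add' := fun _ _ => rfl
      map_smul' := fun _ _ => rfl }

lemma quaternionRe_mul_comm (a b : Quaternion ℝ) :
    quaternionRe (a * b) = quaternionRe (b * a) := by
  change (a * b).re = (b * a).re
  rw [Quaternion.re_mul, Quaternion.re_mul]
  ring

lemma quaternionRe_star_mul_self_pos (a : Quaternion ℝ) (ha : a ≠ 0) :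
    0 < quaternionRe (star a * a) := by
  change 0 < (star a * a).re
  rw [Quaternion.star_mul_self, Quaternion.re_coe]
  exact lt_of_le_of_ne Quaternion.normSq_nonneg (Ne.symm (Quaternion.normSq_ne_zero.mpr ha))

end Groups

theorem statement8 :
    -- Case `F = ℝ`, `K = SO n`:
    (∀ (n : ℕ), 5 ≤ n →
      ∀ H : Set (Matrix (Fin n) (Fin n) ℝ), H ⊆ SOSet n → IsMatSubgroup H →
      ∀ V₁ V₂ V₃ : Submodule ℝ (Fin n → ℝ),
        (∀ h ∈ H, ∀ v ∈ V₁, Matrix.mulVec h v ∈ V₁) →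
        (∀ h ∈ H, ∀ v ∈ V₂, Matrix.mulVec h v ∈ V₂) →
        (∀ h ∈ H, ∀ v ∈ V₃, Matrix.mulVec h v ∈ V₃) →
        V₁ ≠ ⊥ → V₂ ≠ ⊥ → V₃ ≠ ⊥ →
        Disjoint V₁ V₂ → Disjoint (V₁ ⊔ V₂) V₃ → V₁ ⊔ V₂ ⊔ V₃ = ⊤ →
      ∀ G : Set (Matrix (Fin n) (Fin n) ℝ), G ⊆ SOSet n → IsMatSubgroup G →
      ∀ W : Submodule ℝ (Fin n → ℝ), W ≠ ⊥ → W ≠ ⊤ →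
        (∀ g ∈ G, ∀ v ∈ W, Matrix.mulVec g v ∈ W) →
        ¬ lrCohomogeneity G H (SOSet n) ≤ 1) ∧
    -- Case `F = ℂ`, `K = SU n`:
    (∀ (n : ℕ), 5 ≤ n →
      ∀ H : Set (Matrix (Fin n) (Fin n) ℂ), H ⊆ SUSet n → IsMatSubgroup H →
      ∀ V₁ V₂ V₃ : Submodule ℂ (Fin n → ℂ),
        (∀ h ∈ H, ∀ v ∈ V₁, Matrix.mulVec h v ∈ V₁) →
        (∀ h ∈ H, ∀ v ∈ V₂, Matrix.mulVec h v ∈ V₂) →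
        (∀ h ∈ H, ∀ v ∈ V₃, Matrix.mulVec h v ∈ V₃) →
        V₁ ≠ ⊥ → V₂ ≠ ⊥ → V₃ ≠ ⊥ →
        Disjoint V₁ V₂ → Disjoint (V₁ ⊔ V₂) V₃ → V₁ ⊔ V₂ ⊔ V₃ = ⊤ →
      ∀ G : Set (Matrix (Fin n) (Fin n) ℂ), G ⊆ SUSet n → IsMatSubgroup G →
      ∀ W : Submodule ℂ (Fin n → ℂ), W ≠ ⊥ → W ≠ ⊤ →
        (∀ g ∈ G, ∀ v ∈ W, Matrix.mulVec g v ∈ W) →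
        ¬ lrCohomogeneity G H (SUSet n) ≤ 1) ∧
    -- Case `F = ℍ`, `K = Sp n`:
    (∀ (n : ℕ), 5 ≤ n →
      ∀ H : Set (Matrix (Fin n) (Fin n) (Quaternion ℝ)), H ⊆ SpSet n → IsMatSubgroup H →
      ∀ V₁ V₂ V₃ : Submodule (Quaternion ℝ) (Fin n → Quaternion ℝ),
        (∀ h ∈ H, ∀ v ∈ V₁, Matrix.vecMul v h ∈ V₁) →
        (∀ h ∈ H, ∀ v ∈ V₂, Matrix.vecMul v h ∈ V₂) →
        (∀ h ∈ H, ∀ v ∈ V₃, Matrix.vecMul v h ∈ V₃) →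
        V₁ ≠ ⊥ → V₂ ≠ ⊥ → V₃ ≠ ⊥ →
        Disjoint V₁ V₂ → Disjoint (V₁ ⊔ V₂) V₃ → V₁ ⊔ V₂ ⊔ V₃ = ⊤ →
      ∀ G : Set (Matrix (Fin n) (Fin n) (Quaternion ℝ)), G ⊆ SpSet n → IsMatSubgroup G →
      ∀ W : Submodule (Quaternion ℝ) (Fin n → Quaternion ℝ), W ≠ ⊥ → W ≠ ⊤ →
        (∀ g ∈ G, ∀ v ∈ W, Matrix.vecMul v g ∈ W) →
        ¬ lrCohomogeneity G H (SpSet n) ≤ 1) := by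
  refine ⟨?_, ?_, ?_⟩
  · intro n _ H hH hHg V₁ V₂ V₃ h₁ h₂ _ n₁ n₂ n₃ d₁ d₂ _ G hG hGg W hW hW' hGW
    have hre : ∀ a b : ℝ, (ContinuousLinearMap.id ℝ ℝ) (a * b) =
        (ContinuousLinearMap.id ℝ ℝ) (b * a) := fun a b => mul_comm a b
    have hpos : ∀ a : ℝ, a ≠ 0 → 0 < (ContinuousLinearMap.id ℝ ℝ) (star a * a) :=
      fun a ha => mul_self_pos.mpr ha
    have hdef := dotProduct_star_self_eq_zero_of_pos (n := Fin n) hre hpos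
    obtain ⟨p, hp, hp0, hp1, hpc⟩ := exists_commuting_colProjection hdef hGg.2.2 hW hW' hGW
    obtain ⟨e, he, he0, heo, hes, hec⟩ := exists_commuting_colProjections hdef hHg.2.2 h₁ h₂
      n₁ n₂ n₃ d₁ d₂
    refine not_lrCohomogeneity_le_one (by simp [SOSet]) fun k hk =>
      finrank_tangent_orbit_add_two_le hre hpos (fun a ha => ⟨ha.1, ha.2.1⟩)
        (fun a ha b hb => SOSet_mul_mem ha hb) (fun a ha => SOSet_star_mem ha)
        SOSet_bracket_mem hG hH hHg.2.2 hp hp0 hp1 hpc he he0 heo hes hec hk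
  · intro n _ H hH hHg V₁ V₂ V₃ h₁ h₂ _ n₁ n₂ n₃ d₁ d₂ _ G hG hGg W hW hW' hGW
    have hre : ∀ a b : ℂ, Complex.reCLM (a * b) = Complex.reCLM (b * a) :=
      fun a b => congrArg Complex.reCLM (mul_comm a b)
    have hpos : ∀ a : ℂ, a ≠ 0 → 0 < Complex.reCLM (star a * a) := by
      intro a ha
      rw [Complex.star_def, ← Complex.normSq_eq_conj_mul_self]
      exact Complex.normSq_pos.mpr ha
    have hdef := dotProduct_star_self_eq_zero_of_pos (n := Fin n) hre hpos
    obtain ⟨p, hp, hp0, hp1, hpc⟩ := exists_commuting_colProjection hdef hGg.2.2 hW hW' hGW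
    obtain ⟨e, he, he0, heo, hes, hec⟩ := exists_commuting_colProjections hdef hHg.2.2 h₁ h₂
      n₁ n₂ n₃ d₁ d₂
    refine not_lrCohomogeneity_le_one (by simp [SUSet]) fun k hk =>
      finrank_tangent_orbit_add_two_le hre hpos (fun a ha => ⟨ha.1, ha.2.1⟩)
        (fun a ha b hb => SUSet_mul_mem ha hb) (fun a ha => SUSet_star_mem ha)
        SUSet_bracket_mem hG hH hHg.2.2 hp hp0 hp1 hpc he he0 heo hes hec hk
  · intro n _ H hH hHg V₁ V₂ V₃ h₁ h₂ _ n₁ n₂ n₃ d₁ d₂ _ G hG hGg W hW hW' hGW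
    have hdef := dotProduct_star_self_eq_zero_of_pos (n := Fin n) quaternionRe_mul_comm
      quaternionRe_star_mul_self_pos
    obtain ⟨p, hp, hp0, hp1, hpc⟩ := exists_commuting_rowProjection hdef hGg.2.2 hW hW' hGW
    obtain ⟨e, he, he0, heo, hes, hec⟩ := exists_commuting_rowProjections hdef hHg.2.2 h₁ h₂
      n₁ n₂ n₃ d₁ d₂
    refine not_lrCohomogeneity_le_one (by simp [SpSet]) fun k hk =>
      finrank_tangent_orbit_add_two_le quaternionRe_mul_comm quaternionRe_star_mul_self_pos
        (fun a ha => ha) (fun a ha b hb => SpSet_mul_mem ha hb) (fun a ha => SpSet_star_mem ha)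
        SpSet_bracket_mem hG hH hHg.2.2 hp hp0 hp1 hpc he he0 heo hes hec hk
end

section
/- Let G ⊆ K be closed subgroups of O(V), where V is a finite-dimensional real inner product space, and suppose the cohomogeneity of G on V equals the cohomogeneity of K on V plus one. Let v ∈ V be a K-regular point with isotropy group K_v. Then G acts with cohomogeneity one on the principal orbit K·v ≅ K/K_v; equivalently, G × K_v acts with cohomogeneity one on K by left and right translations. -/
/-!
Statement 9: if `G ⊆ K ⊆ O(V)` are closed subgroups and the cohomogeneity of `G` on `V`
is one more than that of `K`, then `G` acts with cohomogeneity one on any principal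
orbit of `K`.
-/

open scoped RealInnerProductSpace
open Module

noncomputable section

variable {V : Type*} [NormedAddCommGroup V] [InnerProductSpace ℝ V]

/-- The tangent space at `v` of a subset `S` of `V`. -/
def tangentAt (S : Set V) (v : V) : Submodule ℝ V :=
  Submodule.span ℝ {w | ∃ c : ℝ → V, (∀ t, c t ∈ S) ∧ c 0 = v ∧ HasDerivAt c w 0}

variable {G : Type*} [Group G]

/-- The orbit of `v` under a representation `ρ`. -/
def orbitOf (ρ : G →* (V ≃ₗᵢ[ℝ] V)) (v : V) : Set V :=
  Set.range fun g => ρ g v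

/-- The dimension of the orbit of `v` under `ρ`. -/
def orbitDim (ρ : G →* (V ≃ₗᵢ[ℝ] V)) (v : V) : ℕ :=
  finrank ℝ (tangentAt (orbitOf ρ v) v)

/-- The cohomogeneity of a representation: `dim V` minus the maximal orbit dimension. -/
def cohomogeneity (ρ : G →* (V ≃ₗᵢ[ℝ] V)) : ℕ :=
  finrank ℝ V - ⨆ v : V, orbitDim ρ v

/-- The dimension of a subset of `V` (as a submanifold, via its tangent spaces). -/
def setDim (S : Set V) : ℕ := ⨆ v : S, finrank ℝ (tangentAt S (v : V))

/-- The cohomogeneity of the action of `G` on an invariant subset `S`. -/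
def cohomogeneityOn (ρ : G →* (V ≃ₗᵢ[ℝ] V)) (S : Set V) : ℕ :=
  setDim S - ⨆ v : S, orbitDim ρ (v : V)

/-- `v` is a regular (principal) point: its orbit has maximal dimension and its isotropy
group is minimal up to conjugacy. -/
def IsPrincipalPoint (ρ : G →* (V ≃ₗᵢ[ℝ] V)) (v : V) : Prop :=
  (∀ w : V, orbitDim ρ w ≤ orbitDim ρ v) ∧
  ∀ w : V, orbitDim ρ w = orbitDim ρ v →
    ∃ g : G, ∀ h : G, ρ h v = v → ρ (g * h * g⁻¹) w = w

end

/-- A telescoping estimate for differences of powers. -/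
theorem norm_pow_sub_pow_le {A : Type*} [NormedRing A] {a b : A} {C : ℝ} (m : ℕ)
    (ha : ∀ k, ‖a ^ k‖ ≤ 1) (hb : ∀ k ≤ m, ‖b ^ k‖ ≤ C) : ‖a ^ m - b ^ m‖ ≤ m * (C * ‖a - b‖) := by
  induction m with
  | zero => simp
  | succ k ih =>
    have e : a ^ (k + 1) - b ^ (k + 1) = a * (a ^ k - b ^ k) + (a - b) * b ^ k := by
      rw [pow_succ', pow_succ']; noncomm_ring
    have h1 := ih fun j hj => hb j (by omega)
    have ha1 : ‖a‖ ≤ 1 := by simpa using ha 1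
    have h2 : ‖a * (a ^ k - b ^ k)‖ ≤ ‖a ^ k - b ^ k‖ :=
      (norm_mul_le _ _).trans (mul_le_of_le_one_left (norm_nonneg _) ha1)
    have h3 : ‖(a - b) * b ^ k‖ ≤ ‖a - b‖ * C :=
      (norm_mul_le _ _).trans (mul_le_mul_of_nonneg_left (hb k (by omega)) (norm_nonneg _))
    rw [e]
    push_cast
    linarith [norm_add_le (a * (a ^ k - b ^ k)) ((a - b) * b ^ k)]

section BanachAlgebra

open NormedSpace Filter Topology

variable {A : Type*} [NormedRing A] [NormedAlgebra ℝ A] [CompleteSpace A]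

theorem continuous_exp_smul (X : A) : Continuous fun t : ℝ => exp (t • X) :=
  (differentiable_exp_smul_const ℝ X).continuous

theorem exp_natCast_mul_smul (X : A) (n : ℕ) (t : ℝ) :
    exp ((n * t : ℝ) • X) = exp (t • X) ^ n := by
  let _ : NormedAlgebra ℚ A := NormedAlgebra.restrictScalars ℚ ℝ A
  rw [← exp_nsmul, mul_smul, Nat.cast_smul_eq_nsmul]

theorem exp_smul_mul_exp_neg_smul (X : A) (t : ℝ) : exp (t • X) * exp (-t • X) = 1 := by
  let _ : NormedAlgebra ℚ A := NormedAlgebra.restrictScalars ℚ ℝ A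
  have h : Commute (t • X) (-t • X) := ((Commute.refl X).smul_left t).smul_right (-t)
  rw [← exp_add_of_commute h, ← add_smul, add_neg_cancel, zero_smul, exp_zero]

theorem tendsto_exp_smul_sub_one_div (X : A) {s : ℕ → ℝ} (hs : ∀ n, 0 < s n)
    (hs0 : Tendsto s atTop (𝓝 0)) :
    Tendsto (fun n => (s n)⁻¹ • (exp (s n • X) - 1)) atTop (𝓝 X) := by
  have h := hasDerivAt_exp_smul_const X (0 : ℝ)
  rw [zero_smul, exp_zero, one_mul, hasDerivAt_iff_tendsto_slope_zero] at h
  have h' : Tendsto s atTop (𝓝[≠] 0) :=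
    tendsto_nhdsWithin_iff.2 ⟨hs0, Eventually.of_forall fun n => (hs n).ne'⟩
  simpa [Function.comp_def, exp_zero] using h.comp h'

/-- A closed group of elements of norm at most one in a Banach algebra. -/
structure IsClosedContractionGroup (H : Submonoid A) : Prop where
  isClosed : IsClosed (H : Set A)
  norm_le : ∀ a ∈ H, ‖a‖ ≤ 1
  exists_inv : ∀ a ∈ H, ∃ b ∈ H, a * b = 1 ∧ b * a = 1

variable {H : Submonoid A}

theorem exp_smul_mem_of_tendsto_of_nonneg (hH : IsClosedContractionGroup H) {u : ℕ → A}
    {s : ℕ → ℝ} {X : A} (hu : ∀ n, u n ∈ H) (hs : ∀ n, 0 < s n) (hs0 : Tendsto s atTop (𝓝 0))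
    (h : Tendsto (fun n => (s n)⁻¹ • (u n - 1)) atTop (𝓝 X)) {t : ℝ} (ht : 0 ≤ t) :
    exp (t • X) ∈ H := by
  set m : ℕ → ℕ := fun n => ⌊t / s n⌋₊ with hm
  have hms_le : ∀ n, m n * s n ≤ t := fun n =>
    (le_div_iff₀ (hs n)).1 (Nat.floor_le (div_nonneg ht (hs n).le))
  have hms_ge : ∀ n, t - s n ≤ m n * s n := fun n => by
    have := (div_lt_iff₀ (hs n)).1 (Nat.lt_floor_add_one (t / s n))
    simp only [hm]
    linarith
  have hms : Tendsto (fun n => m n * s n) atTop (𝓝 t) :=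
    tendsto_of_tendsto_of_tendsto_of_le_of_le (by simpa using tendsto_const_nhds.sub hs0)
      tendsto_const_nhds hms_ge hms_le
  obtain ⟨C, hC⟩ := (isCompact_Icc (a := (0 : ℝ)) (b := t)).exists_bound_of_continuousOn
    (continuous_exp_smul X).continuousOn
  have hexp : Tendsto (fun n => exp (s n • X) ^ m n) atTop (𝓝 (exp (t • X))) := by
    simp_rw [← exp_natCast_mul_smul]
    exact ((continuous_exp_smul X).tendsto t).comp hms
  have hdiff : Tendsto (fun n => (s n)⁻¹ • (u n - exp (s n • X))) atTop (𝓝 0) := by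
    have := h.sub (tendsto_exp_smul_sub_one_div X hs hs0)
    simpa [← smul_sub] using this
  have hpow : Tendsto (fun n => u n ^ m n - exp (s n • X) ^ m n) atTop (𝓝 0) := by
    have hb : Tendsto (fun n => m n * s n * (C * ‖(s n)⁻¹ • (u n - exp (s n • X))‖)) atTop
        (𝓝 0) := by
      simpa using hms.mul (hdiff.norm.const_mul C)
    refine squeeze_zero_norm (fun n => ?_) hb
    refine (norm_pow_sub_pow_le (C := C) (m n) (fun k => hH.norm_le _ (H.pow_mem (hu n) k))
      fun k hk => ?_).trans_eq ?_
    · rw [← exp_natCast_mul_smul]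
      refine hC _ ⟨by have := hs n; positivity, le_trans ?_ (hms_le n)⟩
      exact mul_le_mul_of_nonneg_right (by exact_mod_cast hk) (hs n).le
    · rw [norm_smul, norm_inv, Real.norm_of_nonneg (hs n).le]
      have := (hs n).ne'
      field_simp
  have hlim : Tendsto (fun n => u n ^ m n) atTop (𝓝 (exp (t • X))) := by
    simpa using hpow.add hexp
  exact hH.isClosed.mem_of_tendsto hlim (Eventually.of_forall fun n => H.pow_mem (hu n) _)

theorem exp_smul_mem_of_tendsto (hH : IsClosedContractionGroup H) {u : ℕ → A}
    {s : ℕ → ℝ} {X : A} (hu : ∀ n, u n ∈ H) (hs : ∀ n, 0 < s n) (hs0 : Tendsto s atTop (𝓝 0))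
    (h : Tendsto (fun n => (s n)⁻¹ • (u n - 1)) atTop (𝓝 X)) (t : ℝ) : exp (t • X) ∈ H := by
  rcases le_total 0 t with ht | ht
  · exact exp_smul_mem_of_tendsto_of_nonneg hH hu hs hs0 h ht
  · obtain ⟨b, hb, -, hb'⟩ := hH.exists_inv _
      (exp_smul_mem_of_tendsto_of_nonneg hH hu hs hs0 h (neg_nonneg.2 ht))
    have := exp_smul_mul_exp_neg_smul X (-t)
    rw [neg_neg] at this
    rwa [← left_inv_eq_right_inv hb' this]

theorem exp_smul_add_mem (hH : IsClosedContractionGroup H) {X Y : A}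
    (hX : ∀ t : ℝ, exp (t • X) ∈ H) (hY : ∀ t : ℝ, exp (t • Y) ∈ H) (t : ℝ) :
    exp (t • (X + Y)) ∈ H := by
  have hs : ∀ n : ℕ, 0 < 1 / ((n : ℝ) + 1) := fun n => Nat.one_div_pos_of_nat
  refine exp_smul_mem_of_tendsto hH (s := fun n : ℕ => 1 / ((n : ℝ) + 1))
    (u := fun n : ℕ => exp ((1 / ((n : ℝ) + 1)) • X) * exp ((1 / ((n : ℝ) + 1)) • Y))
    (fun n => H.mul_mem (hX _) (hY _)) hs tendsto_one_div_add_atTop_nhds_zero_nat ?_ t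
  have h1 := tendsto_exp_smul_sub_one_div X hs tendsto_one_div_add_atTop_nhds_zero_nat
  have h2 := tendsto_exp_smul_sub_one_div Y hs tendsto_one_div_add_atTop_nhds_zero_nat
  have h3 := ((continuous_exp_smul Y).tendsto 0).comp tendsto_one_div_add_atTop_nhds_zero_nat
  rw [zero_smul, exp_zero] at h3
  have h4 := (h1.mul h3).add h2
  rw [mul_one] at h4
  refine h4.congr fun n => ?_
  simp only [Function.comp_apply, smul_mul_assoc, ← smul_add]
  congr 1
  noncomm_ring

/-- The Lie algebra of a closed group of contractions. -/
def lieSubspace (H : Submonoid A) (hH : IsClosedContractionGroup H) : Submodule ℝ A where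
  carrier := {X | ∀ t : ℝ, exp (t • X) ∈ H}
  add_mem' hX hY := exp_smul_add_mem hH hX hY
  zero_mem' t := by simp [exp_zero, H.one_mem]
  smul_mem' c X hX t := by
    rw [smul_smul]
    exact hX _

theorem mem_lieSubspace {hH : IsClosedContractionGroup H} {X : A} :
    X ∈ lieSubspace H hH ↔ ∀ t : ℝ, exp (t • X) ∈ H := Iff.rfl

end BanachAlgebra

section Operators

open NormedSpace Filter Topology

variable {V : Type*} [NormedAddCommGroup V] [InnerProductSpace ℝ V]

theorem hasDerivAt_exp_smul_apply [CompleteSpace V] (X : V →L[ℝ] V) (v : V) :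
    HasDerivAt (fun t : ℝ => exp (t • X) v) (X v) 0 := by
  have h := (hasDerivAt_exp_smul_const X (0 : ℝ)).clm_apply (hasDerivAt_const 0 v)
  simpa [exp_zero] using h

theorem exp_smul_apply_eq_self [CompleteSpace V] {X : V →L[ℝ] V} {v : V} (h : X v = 0)
    (t : ℝ) : exp (t • X) v = v := by
  have hconst : ∀ x : ℝ, HasDerivAt (fun t : ℝ => exp (t • X) v) 0 x := fun x => by
    have h' := (hasDerivAt_exp_smul_const X x).clm_apply (hasDerivAt_const x v)
    simpa [h] using h'
  have := is_const_of_deriv_eq_zero (fun x => (hconst x).differentiableAt)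
    (fun x => (hconst x).deriv) t 0
  simpa [exp_zero] using this

variable [FiniteDimensional ℝ V] {H : Submonoid (V →L[ℝ] V)}

/-- A velocity at `v` of a curve in an orbit is the value at `v` of a Lie algebra element. -/
theorem exists_mem_lieSubspace_apply_eq (hH : IsClosedContractionGroup H) {c : ℝ → V} {v w : V}
    (hc : ∀ t, ∃ a ∈ H, a v = c t) (hc0 : c 0 = v) (hw : HasDerivAt c w 0) :
    ∃ X ∈ lieSubspace H hH, X v = w := by
  have hcompact : IsCompact (H : Set (V →L[ℝ] V)) := by
    refine Metric.isCompact_of_isClosed_isBounded hH.isClosed ?_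
    exact (Metric.isBounded_closedBall (x := (0 : V →L[ℝ] V)) (r := 1)).subset fun a ha => by
      simpa using hH.norm_le a ha
  have hmin : ∀ t, ∃ a ∈ H, a v = c t ∧ ∀ b ∈ H, b v = c t → ‖a - 1‖ ≤ ‖b - 1‖ := by
    intro t
    have hcl : IsClosed {a : V →L[ℝ] V | a v = c t} :=
      isClosed_eq (by fun_prop) continuous_const
    obtain ⟨a, ha, hamin⟩ := (hcompact.inter_right hcl).exists_isMinOn (hc t)
      (f := fun a => ‖a - 1‖) (by fun_prop)
    exact ⟨a, ha.1, ha.2, fun b hb hb' => hamin ⟨hb, hb'⟩⟩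
  choose a haH hav hamin using hmin
  set τ : ℕ → ℝ := fun n => 1 / ((n : ℝ) + 1) with hτ
  have hτpos : ∀ n, 0 < τ n := fun n => Nat.one_div_pos_of_nat
  have hτ0 : Tendsto τ atTop (𝓝 0) := tendsto_one_div_add_atTop_nhds_zero_nat
  have hcτ : Tendsto (fun n => c (τ n)) atTop (𝓝 v) := by
    have := hw.continuousAt.tendsto.comp hτ0
    rwa [hc0] at this
  obtain ⟨g, hg, φ, hφ, hφg⟩ := hcompact.tendsto_subseq (x := fun n => a (τ n))
    fun n => haH _
  have hgv : g v = v := by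
    refine tendsto_nhds_unique (f := fun n => c (τ (φ n))) (l := atTop) ?_
      (hcτ.comp hφ.tendsto_atTop)
    have : Tendsto (fun n => (a (τ (φ n))) v) atTop (𝓝 (g v)) :=
      ((ContinuousLinearMap.apply ℝ V v).continuous.tendsto g).comp hφg
    simpa only [hav] using this
  obtain ⟨b, hb, hgb, hbg⟩ := hH.exists_inv g hg
  have hbv : b v = v := by
    have := congrArg (fun f : V →L[ℝ] V => f v) hbg
    simpa [hgv] using this
  have heps : Tendsto (fun n => ‖a (τ (φ n)) - 1‖) atTop (𝓝 0) := by
    have h1 : Tendsto (fun n => ‖a (τ (φ n)) * b - 1‖) atTop (𝓝 0) := by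
      have := ((hφg.mul_const b).sub_const 1).norm
      simpa [hgb] using this
    refine squeeze_zero (fun n => norm_nonneg _) (fun n => ?_) h1
    exact hamin _ _ (H.mul_mem (haH _) hb) (by simp [hbv, hav])
  set s : ℕ → ℝ := fun n => τ (φ n) + ‖a (τ (φ n)) - 1‖ with hsdef
  have hspos : ∀ n, 0 < s n := fun n => add_pos_of_pos_of_nonneg (hτpos _) (norm_nonneg _)
  have hs0 : Tendsto s atTop (𝓝 0) := by
    simpa using (hτ0.comp hφ.tendsto_atTop).add heps
  obtain ⟨⟨X, r⟩, -, ψ, hψ, hlim⟩ :=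
    ((isCompact_closedBall (0 : V →L[ℝ] V) 1).prod
      (isCompact_Icc (a := (0 : ℝ)) (b := 1))).tendsto_subseq
      (x := fun n => ((s n)⁻¹ • (a (τ (φ n)) - 1), (s n)⁻¹ * τ (φ n)))
      (fun n => by
        have h1 := hspos n
        have h2 := hτpos (φ n)
        have h3 := norm_nonneg (a (τ (φ n)) - 1)
        refine ⟨?_, ?_, ?_⟩
        · rw [mem_closedBall_zero_iff, norm_smul, norm_inv, Real.norm_of_nonneg h1.le,
            inv_mul_le_one₀ h1]
          simp only [hsdef]; linarith
        · positivity
        · rw [inv_mul_le_one₀ h1]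
          simp only [hsdef]; linarith)
  rw [nhds_prod_eq] at hlim
  have hX : Tendsto (fun n => (s (ψ n))⁻¹ • (a (τ (φ (ψ n))) - 1)) atTop (𝓝 X) :=
    tendsto_fst.comp hlim
  have hr : Tendsto (fun n => (s (ψ n))⁻¹ * τ (φ (ψ n))) atTop (𝓝 r) :=
    tendsto_snd.comp hlim
  have hsψ0 : Tendsto (fun n => s (ψ n)) atTop (𝓝 0) := hs0.comp hψ.tendsto_atTop
  have hXmem : X ∈ lieSubspace H hH := fun t =>
    exp_smul_mem_of_tendsto hH (fun n => haH (τ (φ (ψ n)))) (fun n => hspos (ψ n)) hsψ0 hX t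
  have hXv : X v = r • w := by
    have h1 : Tendsto (fun n => ((s (ψ n))⁻¹ • (a (τ (φ (ψ n))) - 1)) v) atTop (𝓝 (X v)) :=
      ((ContinuousLinearMap.apply ℝ V v).continuous.tendsto X).comp hX
    refine tendsto_nhds_unique h1 ?_
    rw [hasDerivAt_iff_tendsto_slope_zero] at hw
    have h' : Tendsto (fun n => τ (φ (ψ n))) atTop (𝓝[≠] 0) :=
      tendsto_nhdsWithin_iff.2 ⟨hτ0.comp (hφ.tendsto_atTop.comp hψ.tendsto_atTop),
        Eventually.of_forall fun n => (hτpos _).ne'⟩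
    refine (hr.smul (hw.comp h')).congr fun n => ?_
    have h2 := (hτpos (φ (ψ n))).ne'
    simp only [Function.comp_apply, zero_add, hc0, smul_smul, smul_apply,
      sub_apply, one_apply_eq_self, hav]
    rw [mul_assoc, mul_inv_cancel₀ h2, mul_one]
  by_cases hr0 : r = 0
  · exfalso
    rw [hr0, zero_smul] at hXv
    have hfix := exp_smul_apply_eq_self hXv
    have hnegexp := tendsto_exp_smul_sub_one_div (-X) (fun n => hspos (ψ n)) hsψ0
    have hexp1 := ((continuous_exp_smul (-X)).tendsto 0).comp hsψ0
    rw [zero_smul, exp_zero] at hexp1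
    have hsmall := ((hX.mul hexp1).add hnegexp).norm
    rw [mul_one, add_neg_cancel, norm_zero] at hsmall
    rw [hr0] at hr
    have hle : (1 : ℝ) ≤ 0 + 0 := by
      refine ge_of_tendsto' (hr.add hsmall) fun n => ?_
      set E := exp (s (ψ n) • -X) with hE
      have hEX : E = exp ((-s (ψ n)) • X) := by rw [hE, smul_neg, neg_smul]
      have hEH : E ∈ H := hEX ▸ hXmem _
      have hEv : E v = v := hEX ▸ hfix _
      have hsn := hspos (ψ n)
      have hmin := hamin (τ (φ (ψ n))) (a (τ (φ (ψ n))) * E) (H.mul_mem (haH _) hEH)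
        (by simp [hEv, hav])
      have he : (s (ψ n))⁻¹ • (a (τ (φ (ψ n))) - 1) * E + (s (ψ n))⁻¹ • (E - 1)
          = (s (ψ n))⁻¹ • (a (τ (φ (ψ n))) * E - 1) := by
        rw [smul_mul_assoc, ← smul_add]
        congr 1
        noncomm_ring
      simp only [Function.comp_apply]
      rw [← hE, he, norm_smul, norm_inv, Real.norm_of_nonneg hsn.le, ← mul_add,
        ← inv_mul_cancel₀ hsn.ne']
      refine mul_le_mul_of_nonneg_left ?_ (inv_nonneg.2 hsn.le)
      simp only [hsdef]
      linarith
    norm_num at hle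
  · exact ⟨r⁻¹ • X, (lieSubspace H hH).smul_mem _ hXmem, by
      simp [hXv, smul_smul, inv_mul_cancel₀ hr0]⟩

end Operators

section GenericRank

/-- Linear independence persists along all but finitely many points of an affine line. -/
theorem exists_polynomial_linearIndependent {V : Type*} [AddCommGroup V] [Module ℝ V] {d : ℕ}
    {a : Fin d → V} (b : Fin d → V) (ha : LinearIndependent ℝ a) :
    ∃ p : Polynomial ℝ, p.eval 0 ≠ 0 ∧
      ∀ s : ℝ, p.eval s ≠ 0 → LinearIndependent ℝ fun i => a i + s • b i := by
  obtain ⟨P, hP⟩ := (Fintype.linearCombination ℝ a).exists_leftInverse_of_injective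
    (LinearMap.ker_eq_bot.2 ha.fintypeLinearCombination_injective)
  have hPa : ∀ i, P (a i) = Pi.single i 1 := fun i => by
    have := LinearMap.congr_fun hP (Pi.single i 1)
    simpa using this
  let M : Matrix (Fin d) (Fin d) (Polynomial ℝ) :=
    fun i j => Polynomial.C (P (a i) j) + Polynomial.X * Polynomial.C (P (b i) j)
  have hM : ∀ s : ℝ, M.det.eval s = (Matrix.of fun i => P (a i + s • b i)).det := fun s => by
    rw [← Polynomial.coe_evalRingHom, RingHom.map_det]
    congr 1
    ext i j
    rw [RingHom.mapMatrix_apply, Matrix.map_apply]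
    simp [M, mul_comm s]
  refine ⟨M.det, ?_, fun s hs => ?_⟩
  · have h1 : (Matrix.of fun i => P (a i + (0 : ℝ) • b i)) = 1 := by
      ext i j
      simp [hPa, Matrix.one_apply, Pi.single_apply, eq_comm]
    rw [hM, h1, Matrix.det_one]
    exact one_ne_zero
  · rw [hM] at hs
    exact LinearIndependent.of_comp P (Matrix.linearIndependent_rows_of_det_ne_zero hs)

/-- The subspace of velocities at `x` of a space `L` of operators. -/
noncomputable def evalSubspace {V : Type*} [NormedAddCommGroup V] [NormedSpace ℝ V]
    (L : Submodule ℝ (V →L[ℝ] V)) (x : V) : Submodule ℝ V :=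
  L.map (ContinuousLinearMap.apply ℝ V x).toLinearMap

variable {V : Type*} [NormedAddCommGroup V] [NormedSpace ℝ V]

theorem mem_evalSubspace {L : Submodule ℝ (V →L[ℝ] V)} {x w : V} :
    w ∈ evalSubspace L x ↔ ∃ X ∈ L, X x = w := Iff.rfl

variable [FiniteDimensional ℝ V]

theorem exists_polynomial_finrank_evalSubspace_le (L : Submodule ℝ (V →L[ℝ] V)) (x z : V) :
    ∃ p : Polynomial ℝ, p.eval 0 ≠ 0 ∧ ∀ s : ℝ, p.eval s ≠ 0 →
      finrank ℝ (evalSubspace L x) ≤ finrank ℝ (evalSubspace L (x + s • z)) := by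
  let e := Module.finBasis ℝ (evalSubspace L x)
  have he : ∀ i, ∃ X ∈ L, X x = e i := fun i => mem_evalSubspace.1 (e i).2
  choose X hX hXe using he
  have hli : LinearIndependent ℝ fun i => X i x := by
    simp_rw [hXe]
    exact e.linearIndependent.map' (evalSubspace L x).subtype (Submodule.ker_subtype _)
  obtain ⟨p, hp0, hp⟩ := exists_polynomial_linearIndependent (fun i => X i z) hli
  refine ⟨p, hp0, fun s hs => ?_⟩
  have h := hp s hs
  have h' : LinearIndependent ℝ fun i =>
      (⟨X i (x + s • z), X i, hX i, rfl⟩ : evalSubspace L (x + s • z)) := by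
    refine LinearIndependent.of_comp (evalSubspace L (x + s • z)).subtype ?_
    simpa [Function.comp_def] using h
  simpa using h'.fintype_card_le_finrank

/-- Two spaces of operators attain their ranks at `x` and `y` simultaneously at some point. -/
theorem exists_finrank_evalSubspace_le (L M : Submodule ℝ (V →L[ℝ] V)) (x y : V) :
    ∃ w, finrank ℝ (evalSubspace L x) ≤ finrank ℝ (evalSubspace L w) ∧
      finrank ℝ (evalSubspace M y) ≤ finrank ℝ (evalSubspace M w) := by
  obtain ⟨p, hp0, hp⟩ := exists_polynomial_finrank_evalSubspace_le L x (y - x)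
  obtain ⟨q, hq0, hq⟩ := exists_polynomial_finrank_evalSubspace_le M y (x - y)
  have hne : p * q.comp (1 - Polynomial.X) ≠ 0 := by
    refine mul_ne_zero (fun h => hp0 (by simp [h])) fun h => hq0 ?_
    have := congrArg (Polynomial.eval 1) h
    simpa using this
  obtain ⟨s, hs⟩ : ∃ s, (p * q.comp (1 - Polynomial.X)).eval s ≠ 0 := by
    by_contra! h
    exact hne (Polynomial.funext fun s => by simp [h s])
  rw [Polynomial.eval_mul, mul_ne_zero_iff, Polynomial.eval_comp] at hs
  refine ⟨x + s • (y - x), hp s hs.1, ?_⟩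
  have h := hq (1 - s) (by simpa using hs.2)
  rwa [show y + (1 - s) • (x - y) = x + s • (y - x) by module] at h

theorem finrank_evalSubspace_le_of_apply_eq_zero {L : Submodule ℝ (V →L[ℝ] V)} {x y : V}
    (h : ∀ X ∈ L, X x = 0 → X y = 0) :
    finrank ℝ (evalSubspace L y) ≤ finrank ℝ (evalSubspace L x) := by
  have hrange : ∀ z : V, evalSubspace L z =
      LinearMap.range ((ContinuousLinearMap.apply ℝ V z).toLinearMap.domRestrict L) := fun z =>
    (LinearMap.range_domRestrict _ _).symm
  have hker : LinearMap.ker ((ContinuousLinearMap.apply ℝ V x).toLinearMap.domRestrict L) ≤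
      LinearMap.ker ((ContinuousLinearMap.apply ℝ V y).toLinearMap.domRestrict L) :=
    fun X hX => h X X.2 hX
  have hx := LinearMap.finrank_range_add_finrank_ker
    ((ContinuousLinearMap.apply ℝ V x).toLinearMap.domRestrict L)
  have hy := LinearMap.finrank_range_add_finrank_ker
    ((ContinuousLinearMap.apply ℝ V y).toLinearMap.domRestrict L)
  have := Submodule.finrank_mono hker
  rw [hrange, hrange]
  omega

end GenericRank

section Orbits

open NormedSpace

variable {V : Type*} [NormedAddCommGroup V] [InnerProductSpace ℝ V]

/-- The inclusion of the orthogonal group into the operator algebra. -/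
def isometryToOperator : (V ≃ₗᵢ[ℝ] V) →* (V →L[ℝ] V) where
  toFun f := (f.toContinuousLinearEquiv : V →L[ℝ] V)
  map_one' := rfl
  map_mul' _ _ := rfl

@[simp]
theorem isometryToOperator_apply (f : V ≃ₗᵢ[ℝ] V) (v : V) : isometryToOperator f v = f v := rfl

/-- The submonoid of operators underlying a group of linear isometries. -/
def operatorSubmonoid (G : Subgroup (V ≃ₗᵢ[ℝ] V)) : Submonoid (V →L[ℝ] V) :=
  G.toSubmonoid.map isometryToOperator

theorem isClosedContractionGroup_operatorSubmonoid {G : Subgroup (V ≃ₗᵢ[ℝ] V)}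
    (hG : IsClosed ((fun f : V ≃ₗᵢ[ℝ] V => (f : V → V)) '' (G : Set (V ≃ₗᵢ[ℝ] V)))) :
    IsClosedContractionGroup (operatorSubmonoid G) where
  isClosed := by
    have hcont : Continuous fun a : V →L[ℝ] V => (a : V → V) :=
      continuous_pi fun x => (ContinuousLinearMap.apply ℝ V x).continuous
    suffices h : (operatorSubmonoid G : Set (V →L[ℝ] V)) = (fun a : V →L[ℝ] V => (a : V → V)) ⁻¹'
        ((fun f : V ≃ₗᵢ[ℝ] V => (f : V → V)) '' (G : Set (V ≃ₗᵢ[ℝ] V))) from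
      h ▸ hG.preimage hcont
    ext a
    rw [Set.mem_preimage]
    constructor
    · rintro ⟨f, hf, rfl⟩
      exact ⟨f, hf, rfl⟩
    · rintro ⟨f, hf, hfa⟩
      exact ⟨f, hf, ContinuousLinearMap.coeFn_injective hfa⟩
  norm_le := by
    rintro _ ⟨f, -, rfl⟩
    exact ContinuousLinearMap.opNorm_le_bound _ zero_le_one fun x => by simp
  exists_inv := by
    rintro _ ⟨f, hf, rfl⟩
    refine ⟨_, ⟨f⁻¹, G.inv_mem hf, rfl⟩, ?_, ?_⟩
    · rw [← map_mul, mul_inv_cancel, map_one]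
    · rw [← map_mul, inv_mul_cancel, map_one]

variable [FiniteDimensional ℝ V] {G : Subgroup (V ≃ₗᵢ[ℝ] V)}

theorem tangentAt_orbitOf (hG : IsClosedContractionGroup (operatorSubmonoid G)) (v : V) :
    tangentAt (orbitOf G.subtype v) v = evalSubspace (lieSubspace _ hG) v := by
  refine le_antisymm (Submodule.span_le.2 ?_) fun w hw => Submodule.subset_span ?_
  · rintro w ⟨c, hc, hc0, hw⟩
    refine exists_mem_lieSubspace_apply_eq hG (fun t => ?_) hc0 hw
    obtain ⟨g, hg⟩ := hc t
    exact ⟨_, ⟨g, g.2, rfl⟩, hg⟩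
  · obtain ⟨X, hX, rfl⟩ := mem_evalSubspace.1 hw
    refine ⟨fun t => exp (t • X) v, fun t => ?_, by simp [exp_zero],
      hasDerivAt_exp_smul_apply X v⟩
    obtain ⟨g, hg, hgX⟩ := hX t
    exact ⟨⟨g, hg⟩, by simp [← hgX]⟩

theorem orbitDim_eq_finrank (hG : IsClosedContractionGroup (operatorSubmonoid G)) (v : V) :
    orbitDim G.subtype v = finrank ℝ (evalSubspace (lieSubspace _ hG) v) := by
  rw [orbitDim, tangentAt_orbitOf hG]

/-- Smaller isotropy groups have larger orbits. -/
theorem orbitDim_le_of_isotropy_le (hG : IsClosedContractionGroup (operatorSubmonoid G))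
    {x y : V} (h : ∀ g ∈ G, g x = x → g y = y) :
    orbitDim G.subtype y ≤ orbitDim G.subtype x := by
  rw [orbitDim_eq_finrank hG, orbitDim_eq_finrank hG]
  refine finrank_evalSubspace_le_of_apply_eq_zero fun X hX hXx => ?_
  have hfix : ∀ t : ℝ, exp (t • X) y = y := fun t => by
    obtain ⟨g, hg, hgX⟩ := hX t
    have hgx := exp_smul_apply_eq_self hXx t
    rw [← hgX] at hgx ⊢
    exact h g hg hgx
  have hd := hasDerivAt_exp_smul_apply X y
  simp_rw [hfix] at hd
  exact hd.unique (hasDerivAt_const 0 y)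

theorem orbitDim_le_finrank {Γ : Type*} [Group Γ] (ρ : Γ →* (V ≃ₗᵢ[ℝ] V)) (v : V) :
    orbitDim ρ v ≤ finrank ℝ V := Submodule.finrank_le _

theorem setDim_orbitOf {Γ : Type*} [Group Γ] (ρ : Γ →* (V ≃ₗᵢ[ℝ] V)) {v : V}
    (hv : ∀ w, orbitDim ρ w ≤ orbitDim ρ v) : setDim (orbitOf ρ v) = orbitDim ρ v := by
  have horb : ∀ w ∈ orbitOf ρ v, finrank ℝ (tangentAt (orbitOf ρ v) w) = orbitDim ρ w := by
    rintro _ ⟨g, rfl⟩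
    have : orbitOf ρ (ρ g v) = orbitOf ρ v := by
      ext x
      constructor
      · rintro ⟨k, rfl⟩
        exact ⟨k * g, by simp⟩
      · rintro ⟨k, rfl⟩
        exact ⟨k * g⁻¹, by simp⟩
    rw [orbitDim, this]
  have hmem : v ∈ orbitOf ρ v := ⟨1, by simp⟩
  have : Nonempty (orbitOf ρ v) := ⟨⟨v, hmem⟩⟩
  refine le_antisymm (ciSup_le fun w => (horb w w.2).trans_le (hv w)) ?_
  rw [← horb v hmem]
  exact le_ciSup (f := fun w : orbitOf ρ v => finrank ℝ (tangentAt (orbitOf ρ v) (w : V)))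
    ⟨finrank ℝ V, by rintro _ ⟨w, rfl⟩; exact Submodule.finrank_le _⟩ ⟨v, hmem⟩

/-- A principal orbit of `K` meets the points whose `G`-orbit has maximal dimension. -/
theorem exists_mem_orbitOf_forall_orbitDim_le {K : Subgroup (V ≃ₗᵢ[ℝ] V)} (hGK : G ≤ K)
    (hG : IsClosedContractionGroup (operatorSubmonoid G))
    (hK : IsClosedContractionGroup (operatorSubmonoid K)) {v : V}
    (hv : IsPrincipalPoint K.subtype v) :
    ∃ u ∈ orbitOf K.subtype v, ∀ x, orbitDim G.subtype x ≤ orbitDim G.subtype u := by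
  obtain ⟨x, hx⟩ : ∃ x, ∀ y, orbitDim G.subtype y ≤ orbitDim G.subtype x := by
    have hfin : (Set.range (orbitDim G.subtype)).Finite :=
      (Set.finite_Iic (finrank ℝ V)).subset (by
        rintro _ ⟨y, rfl⟩
        exact orbitDim_le_finrank _ _)
    obtain ⟨_, ⟨x, rfl⟩, hx⟩ := Set.exists_max_image _ id hfin (Set.range_nonempty _)
    exact ⟨x, fun y => hx _ ⟨y, rfl⟩⟩
  obtain ⟨w, hwG, hwK⟩ := exists_finrank_evalSubspace_le (lieSubspace _ hG) (lieSubspace _ hK) x v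
  rw [← orbitDim_eq_finrank, ← orbitDim_eq_finrank] at hwG hwK
  obtain ⟨k, hk⟩ := hv.2 w (le_antisymm (hv.1 w) hwK)
  refine ⟨K.subtype k v, ⟨k, rfl⟩, fun y => ((hx y).trans hwG).trans ?_⟩
  refine orbitDim_le_of_isotropy_le hG fun g hg hgk => ?_
  have h := hk (k⁻¹ * ⟨g, hGK hg⟩ * k) (by
    simp only [map_mul, map_inv, LinearIsometryEquiv.coe_mul, Function.comp_apply]
    refine (congrArg _ hgk).trans ?_
    exact (K.subtype k).symm_apply_apply v)
  rwa [show k * (k⁻¹ * ⟨g, hGK hg⟩ * k) * k⁻¹ = (⟨g, hGK hg⟩ : K) by group] at h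

end Orbits

theorem statement9
    {V : Type} [NormedAddCommGroup V] [InnerProductSpace ℝ V] [FiniteDimensional ℝ V]
    (G K : Subgroup (V ≃ₗᵢ[ℝ] V))
    (hGK : G ≤ K)
    (hGclosed : IsClosed ((fun f : V ≃ₗᵢ[ℝ] V => (f : V → V)) '' (G : Set (V ≃ₗᵢ[ℝ] V))))
    (hKclosed : IsClosed ((fun f : V ≃ₗᵢ[ℝ] V => (f : V → V)) '' (K : Set (V ≃ₗᵢ[ℝ] V))))
    (hcoh : cohomogeneity G.subtype = cohomogeneity K.subtype + 1)
    (v : V) (hreg : IsPrincipalPoint K.subtype v) :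
    cohomogeneityOn G.subtype (orbitOf K.subtype v) = 1 := by
  have hG := isClosedContractionGroup_operatorSubmonoid hGclosed
  have hK := isClosedContractionGroup_operatorSubmonoid hKclosed
  obtain ⟨u, hu, hmax⟩ := exists_mem_orbitOf_forall_orbitDim_le hGK hG hK hreg
  have : Nonempty (orbitOf K.subtype v) := ⟨⟨u, hu⟩⟩
  have hsupG : ⨆ x : V, orbitDim G.subtype x = orbitDim G.subtype u :=
    le_antisymm (ciSup_le hmax) (le_ciSup ⟨_, Set.forall_mem_range.2 hmax⟩ u)
  have hsupK : ⨆ x : V, orbitDim K.subtype x = orbitDim K.subtype v :=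
    le_antisymm (ciSup_le hreg.1) (le_ciSup ⟨_, Set.forall_mem_range.2 hreg.1⟩ v)
  have hsup : ⨆ x : orbitOf K.subtype v, orbitDim G.subtype (x : V) = orbitDim G.subtype u :=
    le_antisymm (ciSup_le fun x => hmax x)
      (le_ciSup (f := fun x : orbitOf K.subtype v => orbitDim G.subtype (x : V))
        ⟨_, Set.forall_mem_range.2 fun x => hmax x⟩ ⟨u, hu⟩)
  have hKle := orbitDim_le_finrank K.subtype v
  rw [cohomogeneity, cohomogeneity, hsupG, hsupK] at hcoh
  rw [cohomogeneityOn, setDim_orbitOf _ hreg.1, hsup]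
  omega
end
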